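/- arXiv:math/0105056 — 16 statements merged into one kernel-verified Lean document; each statement's English description precedes it below -/
import Mathlib

section
/- Under the scaled ABS recursions carried out with nonzero denominators through step i ≤ m, the Abaffian H_{i+1} satisfies H_{i+1} Aᵀ v_j = 0 and H_{i+1}ᵀ w_j = 0 for every j with 1 ≤ j ≤ i. -/
open Matrix

section RankOneUpdate

variable {ι K : Type*} [Fintype ι] [Field K]

/-- The rank-one downdate `M - M y wᵀ M / (wᵀ M y)` applied to a vector. -/
theorem rankOneDowndate_mulVec (M : Matrix ι ι K) (y w u : ι → K) :
    (M - (w ⬝ᵥ (M *ᵥ y))⁻¹ • vecMulVec (M *ᵥ y) (w ᵥ* M)) *ᵥ u =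
      M *ᵥ u - ((w ⬝ᵥ (M *ᵥ y))⁻¹ * (w ⬝ᵥ (M *ᵥ u))) • (M *ᵥ y) := by
  rw [sub_mulVec, smul_mulVec, vecMulVec_mulVec, op_smul_eq_smul, smul_smul,
    dotProduct_mulVec w M u]

/-- The rank-one downdate `M - M y wᵀ M / (wᵀ M y)` applied to a row vector. -/
theorem vecMul_rankOneDowndate (M : Matrix ι ι K) (y w u : ι → K) :
    u ᵥ* (M - (w ⬝ᵥ (M *ᵥ y))⁻¹ • vecMulVec (M *ᵥ y) (w ᵥ* M)) =
      u ᵥ* M - ((w ⬝ᵥ (M *ᵥ y))⁻¹ * (u ⬝ᵥ (M *ᵥ y))) • (w ᵥ* M) := by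
  rw [vecMul_sub, vecMul_smul, vecMul_vecMulVec, smul_smul]

/-- Successive rank-one downdates annihilate all the vectors used so far, on both sides. -/
theorem rankOneDowndate_annihilates (M : ℕ → Matrix ι ι K) (y w : ℕ → ι → K) (i : ℕ)
    (hd : ∀ k < i, w k ⬝ᵥ (M k *ᵥ y k) ≠ 0)
    (hM : ∀ k < i, M (k + 1) =
      M k - (w k ⬝ᵥ (M k *ᵥ y k))⁻¹ • vecMulVec (M k *ᵥ y k) (w k ᵥ* M k)) :
    ∀ j < i, M i *ᵥ y j = 0 ∧ w j ᵥ* M i = 0 := by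
  induction i with
  | zero => simp
  | succ i ih =>
    intro j hj
    rw [hM i i.lt_succ_self, rankOneDowndate_mulVec, vecMul_rankOneDowndate]
    rcases Nat.lt_succ_iff_lt_or_eq.mp hj with hji | rfl
    · obtain ⟨hy, hw⟩ := ih (fun k hk => hd k (hk.trans i.lt_succ_self))
        (fun k hk => hM k (hk.trans i.lt_succ_self)) j hji
      simp [hy, hw, dotProduct_mulVec (w j)]
    · simp [inv_mul_cancel₀ (hd j hj)]

end RankOneUpdate

/-- Under the scaled ABS recursions carried out with nonzero
denominators through step `i ≤ m`, the Abaffian `H_{i+1}` (here `H i`, with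
`H 0` the initial nonsingular matrix) satisfies `H_{i+1} Aᵀ v_j = 0` and
`H_{i+1}ᵀ w_j = 0` for every `j` with `1 ≤ j ≤ i` (here `j < i`, 0-based). -/
theorem abs_abaffian_annihilates
    {m n : ℕ} (hmn : m ≤ n)
    (A : Matrix (Fin m) (Fin n) ℝ) (b : Fin m → ℝ)
    (H : ℕ → Matrix (Fin n) (Fin n) ℝ) (x : ℕ → Fin n → ℝ)
    (v : ℕ → Fin m → ℝ) (z w : ℕ → Fin n → ℝ)
    (p : ℕ → Fin n → ℝ) (α : ℕ → ℝ)
    (hH1 : (H 0).det ≠ 0)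
    (i : ℕ) (hi : i ≤ m)
    (hp : ∀ k < i, p k = (H k)ᵀ *ᵥ z k)
    (hα : ∀ k < i, α k = (v k ⬝ᵥ (A *ᵥ x k - b)) / (v k ⬝ᵥ (A *ᵥ p k)))
    (hx : ∀ k < i, x (k + 1) = x k - α k • p k)
    (hd1 : ∀ k < i, v k ⬝ᵥ (A *ᵥ ((H k)ᵀ *ᵥ z k)) ≠ 0)
    (hd2 : ∀ k < i, w k ⬝ᵥ (H k *ᵥ (Aᵀ *ᵥ v k)) ≠ 0)
    (hH : ∀ k < i, H (k + 1) =
      H k - (w k ⬝ᵥ (H k *ᵥ (Aᵀ *ᵥ v k)))⁻¹ •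
        vecMulVec (H k *ᵥ (Aᵀ *ᵥ v k)) (w k ᵥ* H k)) :
    ∀ j < i, H i *ᵥ (Aᵀ *ᵥ v j) = 0 ∧ (H i)ᵀ *ᵥ w j = 0 := by
  simpa only [mulVec_transpose] using
    rankOneDowndate_annihilates H (fun k => Aᵀ *ᵥ v k) w i hd2 hH
end

section
/- Under the scaled ABS recursions carried out with nonzero denominators through step i ≤ m, the iterate x_{i+1} satisfies the Petrov–Galerkin conditions v_jᵀ (A x_{i+1} − b) = 0 for every j with 1 ≤ j ≤ i. -/
open Matrix

/-- The ABS update `H - (wᵀ H a)⁻¹ • H a wᵀ H` applied to a vector `c`. -/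
theorem abs_update_mulVec {n : ℕ} (H : Matrix (Fin n) (Fin n) ℝ) (a w c : Fin n → ℝ) :
    (H - (w ⬝ᵥ (H *ᵥ a))⁻¹ • vecMulVec (H *ᵥ a) (w ᵥ* H)) *ᵥ c =
      H *ᵥ c - ((w ⬝ᵥ (H *ᵥ a))⁻¹ * (w ⬝ᵥ (H *ᵥ c))) • (H *ᵥ a) := by
  rw [sub_mulVec, smul_mulVec, vecMulVec_mulVec, ← dotProduct_mulVec, op_smul_eq_smul, smul_smul]

/-- Moving `A` and `Hᵀ` across the dot product: `vᵀ A Hᵀ z = (H Aᵀ v)ᵀ z`. -/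
theorem dotProduct_mulVec_transpose_mulVec {m n : ℕ} (A : Matrix (Fin m) (Fin n) ℝ)
    (H : Matrix (Fin n) (Fin n) ℝ) (v : Fin m → ℝ) (z : Fin n → ℝ) :
    v ⬝ᵥ (A *ᵥ (Hᵀ *ᵥ z)) = (H *ᵥ (Aᵀ *ᵥ v)) ⬝ᵥ z := by
  rw [dotProduct_mulVec, ← mulVec_transpose, dotProduct_mulVec, vecMul_transpose]

/-- Under the scaled ABS recursions carried out with nonzero
denominators through step `i ≤ m`, the iterate `x_{i+1}` (here `x i`, with
`x 0` the starting point) satisfies the Petrov–Galerkin conditions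
`v_jᵀ (A x_{i+1} − b) = 0` for every `j` with `1 ≤ j ≤ i` (here `j < i`). -/
theorem abs_petrov_galerkin
    {m n : ℕ} (hmn : m ≤ n)
    (A : Matrix (Fin m) (Fin n) ℝ) (b : Fin m → ℝ)
    (H : ℕ → Matrix (Fin n) (Fin n) ℝ) (x : ℕ → Fin n → ℝ)
    (v : ℕ → Fin m → ℝ) (z w : ℕ → Fin n → ℝ)
    (p : ℕ → Fin n → ℝ) (α : ℕ → ℝ)
    (hH1 : (H 0).det ≠ 0)
    (i : ℕ) (hi : i ≤ m)
    (hp : ∀ k < i, p k = (H k)ᵀ *ᵥ z k)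
    (hα : ∀ k < i, α k = (v k ⬝ᵥ (A *ᵥ x k - b)) / (v k ⬝ᵥ (A *ᵥ p k)))
    (hx : ∀ k < i, x (k + 1) = x k - α k • p k)
    (hd1 : ∀ k < i, v k ⬝ᵥ (A *ᵥ ((H k)ᵀ *ᵥ z k)) ≠ 0)
    (hd2 : ∀ k < i, w k ⬝ᵥ (H k *ᵥ (Aᵀ *ᵥ v k)) ≠ 0)
    (hH : ∀ k < i, H (k + 1) =
      H k - (w k ⬝ᵥ (H k *ᵥ (Aᵀ *ᵥ v k)))⁻¹ •
        vecMulVec (H k *ᵥ (Aᵀ *ᵥ v k)) (w k ᵥ* H k)) :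
    ∀ j < i, v j ⬝ᵥ (A *ᵥ x i - b) = 0 := by
  suffices key : ∀ k ≤ i, ∀ j < k,
      H k *ᵥ (Aᵀ *ᵥ v j) = 0 ∧ v j ⬝ᵥ (A *ᵥ x k - b) = 0 from
    fun j hj => (key i le_rfl j hj).2
  intro k
  induction k with
  | zero => intro _ j hj; exact absurd hj (Nat.not_lt_zero j)
  | succ k ih =>
    intro hk j hj
    have hki : k < i := hk
    have hres : v j ⬝ᵥ (A *ᵥ x (k + 1) - b) =
        v j ⬝ᵥ (A *ᵥ x k - b) - α k * (v j ⬝ᵥ (A *ᵥ p k)) := by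
      rw [hx k hki, mulVec_sub, mulVec_smul, sub_right_comm, dotProduct_sub _ (A *ᵥ x k - b),
        dotProduct_smul, smul_eq_mul]
    rw [hH k hki, abs_update_mulVec, hres]
    rcases Nat.lt_succ_iff_lt_or_eq.mp hj with hlt | rfl
    · obtain ⟨hnull, horth⟩ := ih hki.le j hlt
      rw [horth, hp k hki, dotProduct_mulVec_transpose_mulVec, hnull]
      simp
    · refine ⟨?_, ?_⟩
      · rw [inv_mul_cancel₀ (hd2 j hki), one_smul, sub_self]
      · have hd : v j ⬝ᵥ (A *ᵥ p j) ≠ 0 := by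
          rw [hp j hki]
          exact hd1 j hki
        rw [hα j hki, div_mul_cancel₀ _ hd, sub_self]
end

section
/- Under the scaled ABS recursions carried out with nonzero denominators through step i−1, the vector sᵢ = Hᵢ Aᵀ vᵢ is zero if and only if Aᵀ vᵢ lies in the linear span of Aᵀ v₁, …, Aᵀ v_{i−1}; likewise, for any w ∈ ℝⁿ, Hᵢᵀ w = 0 if and only if w lies in the linear span of w₁, …, w_{i−1}. -/
open Matrix

/-- Deflating `M` by the rank-one matrix `(M c)(wᵀ M) / (wᵀ M c)` enlarges its kernel exactly
by the direction `c`. -/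
theorem deflation_mulVec_eq_zero_iff {K n : Type*} [Field K] [Fintype n]
    (M : Matrix n n K) (c w : n → K) (hd : w ⬝ᵥ (M *ᵥ c) ≠ 0) (u : n → K) :
    (M - (w ⬝ᵥ (M *ᵥ c))⁻¹ • vecMulVec (M *ᵥ c) (w ᵥ* M)) *ᵥ u = 0 ↔
      ∃ t : K, ∃ y, M *ᵥ y = 0 ∧ u = t • c + y := by
  have key : (M - (w ⬝ᵥ (M *ᵥ c))⁻¹ • vecMulVec (M *ᵥ c) (w ᵥ* M)) *ᵥ u =
      M *ᵥ u - ((w ⬝ᵥ (M *ᵥ c))⁻¹ * (w ⬝ᵥ (M *ᵥ u))) • (M *ᵥ c) := by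
    rw [sub_mulVec, smul_mulVec, vecMulVec_mulVec, op_smul_eq_smul, smul_smul,
      ← dotProduct_mulVec]
  rw [key]
  constructor
  · intro h
    refine ⟨(w ⬝ᵥ (M *ᵥ c))⁻¹ * (w ⬝ᵥ (M *ᵥ u)),
      u - ((w ⬝ᵥ (M *ᵥ c))⁻¹ * (w ⬝ᵥ (M *ᵥ u))) • c, ?_, by abel⟩
    rw [mulVec_sub, mulVec_smul, h]
  · rintro ⟨t, y, hy, rfl⟩
    have hu : M *ᵥ (t • c + y) = t • (M *ᵥ c) := by
      rw [mulVec_add, mulVec_smul, hy, add_zero]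
    rw [hu, dotProduct_smul, smul_eq_mul, mul_comm t, inv_mul_cancel_left₀ hd, sub_self]

/-- The kernel of an iterated rank-one deflation of a nonsingular matrix is the span of the
deflated directions. -/
theorem iterated_deflation_mulVec_eq_zero_iff {K n : Type*} [Field K] [Fintype n] [DecidableEq n]
    (M : ℕ → Matrix n n K) (c w : ℕ → n → K) (h0 : (M 0).det ≠ 0) (i : ℕ)
    (hd : ∀ k < i, w k ⬝ᵥ (M k *ᵥ c k) ≠ 0)
    (hM : ∀ k < i, M (k + 1) = M k - (w k ⬝ᵥ (M k *ᵥ c k))⁻¹ •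
      vecMulVec (M k *ᵥ c k) (w k ᵥ* M k)) (u : n → K) :
    M i *ᵥ u = 0 ↔ u ∈ Submodule.span K (Set.range fun k : Fin i => c k.1) := by
  induction i generalizing u with
  | zero =>
    rw [Set.range_eq_empty, Submodule.span_empty, Submodule.mem_bot]
    exact ⟨eq_zero_of_mulVec_eq_zero h0, fun h => by rw [h, mulVec_zero]⟩
  | succ i ih =>
    have hrange : (Set.range fun k : Fin (i + 1) => c k.1) =
        insert (c i) (Set.range fun k : Fin i => c k.1) := by
      ext y
      simp [Fin.exists_fin_succ', or_comm, eq_comm]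
    rw [hrange, Submodule.mem_span_insert, hM i i.lt_succ_self,
      deflation_mulVec_eq_zero_iff _ _ _ (hd i i.lt_succ_self)]
    simp_rw [ih (fun k hk => hd k (hk.trans i.lt_succ_self))
      (fun k hk => hM k (hk.trans i.lt_succ_self))]

/-- Under the scaled ABS recursions carried out with nonzero
denominators through step `i−1` (here: `k < i`, 0-based, producing the
Abaffian `H_i`, here `H i`), the vector `sᵢ = Hᵢ Aᵀ vᵢ` is zero iff `Aᵀ vᵢ`
lies in the span of `Aᵀ v₁, …, Aᵀ v_{i−1}`; likewise, for any `u ∈ ℝⁿ`,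
`Hᵢᵀ u = 0` iff `u` lies in the span of `w₁, …, w_{i−1}`. -/
theorem abs_null_space_characterization
    {m n : ℕ} (hmn : m ≤ n)
    (A : Matrix (Fin m) (Fin n) ℝ) (b : Fin m → ℝ)
    (H : ℕ → Matrix (Fin n) (Fin n) ℝ) (x : ℕ → Fin n → ℝ)
    (v : ℕ → Fin m → ℝ) (z w : ℕ → Fin n → ℝ)
    (p : ℕ → Fin n → ℝ) (α : ℕ → ℝ)
    (hH1 : (H 0).det ≠ 0)
    (i : ℕ) (hi : i < m)
    (hp : ∀ k < i, p k = (H k)ᵀ *ᵥ z k)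
    (hα : ∀ k < i, α k = (v k ⬝ᵥ (A *ᵥ x k - b)) / (v k ⬝ᵥ (A *ᵥ p k)))
    (hx : ∀ k < i, x (k + 1) = x k - α k • p k)
    (hd1 : ∀ k < i, v k ⬝ᵥ (A *ᵥ ((H k)ᵀ *ᵥ z k)) ≠ 0)
    (hd2 : ∀ k < i, w k ⬝ᵥ (H k *ᵥ (Aᵀ *ᵥ v k)) ≠ 0)
    (hH : ∀ k < i, H (k + 1) =
      H k - (w k ⬝ᵥ (H k *ᵥ (Aᵀ *ᵥ v k)))⁻¹ •
        vecMulVec (H k *ᵥ (Aᵀ *ᵥ v k)) (w k ᵥ* H k)) :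
    (H i *ᵥ (Aᵀ *ᵥ v i) = 0 ↔
      Aᵀ *ᵥ v i ∈ Submodule.span ℝ (Set.range fun k : Fin i => Aᵀ *ᵥ v k.1)) ∧
    (∀ u : Fin n → ℝ, (H i)ᵀ *ᵥ u = 0 ↔
      u ∈ Submodule.span ℝ (Set.range fun k : Fin i => w k.1)) := by
  have hswap : ∀ k, (Aᵀ *ᵥ v k) ⬝ᵥ ((H k)ᵀ *ᵥ w k) = w k ⬝ᵥ (H k *ᵥ (Aᵀ *ᵥ v k)) := fun k => by
    rw [mulVec_transpose (H k), dotProduct_comm, dotProduct_mulVec (w k)]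
  refine ⟨iterated_deflation_mulVec_eq_zero_iff H (fun k => Aᵀ *ᵥ v k) w hH1 i hd2 hH _,
    iterated_deflation_mulVec_eq_zero_iff (fun k => (H k)ᵀ) w (fun k => Aᵀ *ᵥ v k)
      (by rwa [det_transpose]) i (fun k hk => ?_) (fun k hk => ?_)⟩
  · rw [hswap]
    exact hd2 k hk
  · rw [hswap, hH k hk, transpose_sub, transpose_smul, transpose_vecMulVec, mulVec_transpose (H k),
      vecMul_transpose]
end

section
/- Suppose m = n, A is a nonsingular real n×n matrix, and the scaled ABS recursions are carried out with nonzero denominators through all n steps with v₁,…,v_n linearly independent. Let P be the n×n matrix with columns p₁,…,p_n, V the n×n matrix with columns v₁,…,v_n, and L = Vᵀ A P. Then L is invertible and A⁻¹ = P L⁻¹ Vᵀ. -/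
open Matrix

/-- One step of the ABS update of the matrix `M` annihilates every vector that `M` annihilates,
as well as the vector `u` it is built from. -/
theorem abs_update_mulVec_eq_zero {n : ℕ} {M : Matrix (Fin n) (Fin n) ℝ} {u w y : Fin n → ℝ}
    (hd : w ⬝ᵥ (M *ᵥ u) ≠ 0) (hy : M *ᵥ y = 0 ∨ y = u) :
    (M - (w ⬝ᵥ (M *ᵥ u))⁻¹ • vecMulVec (M *ᵥ u) (w ᵥ* M)) *ᵥ y = 0 := by
  rw [sub_mulVec, smul_mulVec, vecMulVec_mulVec, ← dotProduct_mulVec]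
  rcases hy with hy | rfl
  · simp [hy]
  · ext r
    simp only [Pi.sub_apply, Pi.smul_apply, Pi.zero_apply, smul_eq_mul, MulOpposite.smul_eq_mul_unop,
      MulOpposite.unop_op]
    field_simp
    ring

/-- Suppose `m = n`, `A` is a nonsingular real `n×n` matrix,
and the scaled ABS recursions are carried out with nonzero denominators
through all `n` steps with `v₁,…,v_n` linearly independent. Let `P` have
columns `p₁,…,p_n`, `V` have columns `v₁,…,v_n`, and `L = Vᵀ A P`. Then `L`
is invertible and `A⁻¹ = P L⁻¹ Vᵀ`. -/
theorem abs_semiexplicit_inverse_factorization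
    {n : ℕ}
    (A : Matrix (Fin n) (Fin n) ℝ) (b : Fin n → ℝ)
    (hA : IsUnit A.det)
    (H : ℕ → Matrix (Fin n) (Fin n) ℝ) (x : ℕ → Fin n → ℝ)
    (v : ℕ → Fin n → ℝ) (z w : ℕ → Fin n → ℝ)
    (p : ℕ → Fin n → ℝ) (α : ℕ → ℝ)
    (hH1 : (H 0).det ≠ 0)
    (hv : LinearIndependent ℝ (fun k : Fin n => v k.1))
    (hp : ∀ k < n, p k = (H k)ᵀ *ᵥ z k)
    (hα : ∀ k < n, α k = (v k ⬝ᵥ (A *ᵥ x k - b)) / (v k ⬝ᵥ (A *ᵥ p k)))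
    (hx : ∀ k < n, x (k + 1) = x k - α k • p k)
    (hd1 : ∀ k < n, v k ⬝ᵥ (A *ᵥ ((H k)ᵀ *ᵥ z k)) ≠ 0)
    (hd2 : ∀ k < n, w k ⬝ᵥ (H k *ᵥ (Aᵀ *ᵥ v k)) ≠ 0)
    (hH : ∀ k < n, H (k + 1) =
      H k - (w k ⬝ᵥ (H k *ᵥ (Aᵀ *ᵥ v k)))⁻¹ •
        vecMulVec (H k *ᵥ (Aᵀ *ᵥ v k)) (w k ᵥ* H k))
    (P V L : Matrix (Fin n) (Fin n) ℝ)
    (hP : ∀ r c : Fin n, P r c = p c.1 r)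
    (hV : ∀ r c : Fin n, V r c = v c.1 r)
    (hL : L = Vᵀ * A * P) :
    IsUnit L.det ∧ A⁻¹ = P * L⁻¹ * Vᵀ := by
  have annihilates : ∀ k ≤ n, ∀ j < k, H k *ᵥ (Aᵀ *ᵥ v j) = 0 := by
    intro k
    induction k with
    | zero => intro _ j hj; omega
    | succ k ih =>
      intro hk j hj
      rw [hH k hk]
      refine abs_update_mulVec_eq_zero (hd2 k hk) ?_
      rcases Nat.lt_succ_iff_lt_or_eq.mp hj with hj | rfl
      · exact Or.inl (ih (by omega) j hj)
      · exact Or.inr rfl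
  have L_apply : ∀ i j : Fin n, L i j = v i ⬝ᵥ (A *ᵥ ((H j)ᵀ *ᵥ z j)) := by
    intro i j
    have hVi : Vᵀ.row i = v i := funext fun r => hV r i
    have hPj : P.col j = p j := funext fun r => hP r j
    rw [hL, Matrix.mul_assoc, mul_apply_eq_vecMul, ← hp j j.2, ← hPj, ← hVi]
    rfl
  have triangular : L.BlockTriangular OrderDual.toDual := by
    intro i j hij
    have hij : (i : ℕ) < j := hij
    rw [L_apply, dotProduct_mulVec, dotProduct_mulVec, ← mulVec_transpose A,
      vecMul_transpose, annihilates j j.2.le i hij, zero_dotProduct]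
  have hdet : IsUnit L.det := by
    rw [det_of_isLowerTriangular L triangular, isUnit_iff_ne_zero]
    exact Finset.prod_ne_zero_iff.mpr fun i _ => L_apply i i ▸ hd1 i i.2
  refine ⟨hdet, inv_eq_right_inv ?_⟩
  rw [← Matrix.mul_assoc, mul_eq_one_comm, ← Matrix.mul_assoc, ← Matrix.mul_assoc,
    ← hL, mul_nonsing_inv L hdet]
end

section
/- Under the scaled ABS recursions carried out with nonzero denominators through step i ≤ m, let V_i be the m×i matrix with columns v₁,…,v_i and W_i the n×i matrix with columns w₁,…,w_i. Then the i×i matrix W_iᵀ H₁ Aᵀ V_i is invertible and the Abaffian admits the explicit representation H_{i+1} = H₁ − H₁ Aᵀ V_i (W_iᵀ H₁ Aᵀ V_i)⁻¹ W_iᵀ H₁. -/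
open Matrix

/-- A rank-one Abaffian update preserves the property that `H k` differs from `H 0` by a matrix
factoring through the vectors `H 0 *ᵥ a j`, the columns of `B`. -/
theorem abaffian_exists_factor {n i : ℕ} (H : ℕ → Matrix (Fin n) (Fin n) ℝ)
    (a w : ℕ → Fin n → ℝ) (d : ℕ → ℝ)
    (hH : ∀ k < i, H (k + 1) = H k - d k • vecMulVec (H k *ᵥ a k) (w k ᵥ* H k))
    (B : Matrix (Fin n) (Fin i) ℝ) (hB : ∀ k : Fin i, B *ᵥ Pi.single k 1 = H 0 *ᵥ a k) :
    ∀ k ≤ i, ∃ N : Matrix (Fin i) (Fin n) ℝ, H k = H 0 - B * N := by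
  intro k
  induction k with
  | zero => exact fun _ => ⟨0, by simp⟩
  | succ k ih =>
    intro hk
    obtain ⟨N, hN⟩ := ih (by omega)
    have hHa : H k *ᵥ a k = B *ᵥ (Pi.single ⟨k, hk⟩ 1 - N *ᵥ a k) := by
      rw [mulVec_sub, hB, hN, sub_mulVec, mulVec_mulVec]
    refine ⟨N + d k • vecMulVec (Pi.single ⟨k, hk⟩ 1 - N *ᵥ a k) (w k ᵥ* H k), ?_⟩
    rw [hH k hk, hHa, Matrix.mul_add, Matrix.mul_smul, mul_vecMulVec, ← sub_sub, ← hN]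

/-- The Abaffian annihilates all earlier parameters `w j` from the left. -/
theorem abaffian_vecMul_eq_zero {n i : ℕ} (H : ℕ → Matrix (Fin n) (Fin n) ℝ)
    (a w : ℕ → Fin n → ℝ) (hd : ∀ k < i, w k ⬝ᵥ (H k *ᵥ a k) ≠ 0)
    (hH : ∀ k < i, H (k + 1) =
      H k - (w k ⬝ᵥ (H k *ᵥ a k))⁻¹ • vecMulVec (H k *ᵥ a k) (w k ᵥ* H k)) :
    ∀ k ≤ i, ∀ j < k, w j ᵥ* H k = 0 := by
  intro k
  induction k with
  | zero => intro _ j hj; omega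
  | succ k ih =>
    intro hk j hj
    rw [hH k hk, vecMul_sub, vecMul_smul, vecMul_vecMulVec]
    rcases Nat.lt_succ_iff_lt_or_eq.mp hj with h | rfl
    · have h0 := ih (by omega) j h
      rw [dotProduct_mulVec (w j), h0]
      simp
    · rw [smul_smul, inv_mul_cancel₀ (hd j hk), one_smul, sub_self]

/-- Under the scaled ABS recursions carried out with nonzero
denominators through step `i ≤ m`, with `V_i` the `m×i` matrix of columns
`v₁,…,v_i` and `W_i` the `n×i` matrix of columns `w₁,…,w_i`, the `i×i` matrix
`W_iᵀ H₁ Aᵀ V_i` is invertible and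
`H_{i+1} = H₁ − H₁ Aᵀ V_i (W_iᵀ H₁ Aᵀ V_i)⁻¹ W_iᵀ H₁` (here `H i` and `H 0`). -/
theorem abs_explicit_abaffian_representation
    {m n : ℕ} (hmn : m ≤ n)
    (A : Matrix (Fin m) (Fin n) ℝ) (b : Fin m → ℝ)
    (H : ℕ → Matrix (Fin n) (Fin n) ℝ) (x : ℕ → Fin n → ℝ)
    (v : ℕ → Fin m → ℝ) (z w : ℕ → Fin n → ℝ)
    (p : ℕ → Fin n → ℝ) (α : ℕ → ℝ)
    (hH1 : (H 0).det ≠ 0)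
    (i : ℕ) (hi : i ≤ m)
    (hp : ∀ k < i, p k = (H k)ᵀ *ᵥ z k)
    (hα : ∀ k < i, α k = (v k ⬝ᵥ (A *ᵥ x k - b)) / (v k ⬝ᵥ (A *ᵥ p k)))
    (hx : ∀ k < i, x (k + 1) = x k - α k • p k)
    (hd1 : ∀ k < i, v k ⬝ᵥ (A *ᵥ ((H k)ᵀ *ᵥ z k)) ≠ 0)
    (hd2 : ∀ k < i, w k ⬝ᵥ (H k *ᵥ (Aᵀ *ᵥ v k)) ≠ 0)
    (hH : ∀ k < i, H (k + 1) =
      H k - (w k ⬝ᵥ (H k *ᵥ (Aᵀ *ᵥ v k)))⁻¹ •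
        vecMulVec (H k *ᵥ (Aᵀ *ᵥ v k)) (w k ᵥ* H k))
    (Vi : Matrix (Fin m) (Fin i) ℝ) (hVi : ∀ r c, Vi r c = v c.1 r)
    (Wi : Matrix (Fin n) (Fin i) ℝ) (hWi : ∀ r c, Wi r c = w c.1 r)
    (Q : Matrix (Fin i) (Fin i) ℝ) (hQ : Q = Wiᵀ * H 0 * Aᵀ * Vi) :
    IsUnit Q.det ∧ H i = H 0 - H 0 * Aᵀ * Vi * Q⁻¹ * (Wiᵀ * H 0) := by
  set a : ℕ → Fin n → ℝ := fun k => Aᵀ *ᵥ v k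
  have hVi_col (k : Fin i) : Vi *ᵥ Pi.single k 1 = v k := by
    ext r; simp [hVi]
  have hB (k : Fin i) : (H 0 * Aᵀ * Vi) *ᵥ Pi.single k 1 = H 0 *ᵥ a k := by
    rw [← mulVec_mulVec, ← mulVec_mulVec, hVi_col]
  have hfac := abaffian_exists_factor H a w _ hH _ hB
  have hzero := abaffian_vecMul_eq_zero H a w hd2 hH
  have hQB : Q = Wiᵀ * (H 0 * Aᵀ * Vi) := by simp only [hQ, Matrix.mul_assoc]
  have hWrow (c : Fin i → ℝ) (M : Matrix (Fin n) (Fin n) ℝ) :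
      c ᵥ* (Wiᵀ * M) = ∑ j : Fin i, c j • (w j ᵥ* M) := by
    have hc : c ᵥ* Wiᵀ = ∑ j : Fin i, c j • w j := by
      ext r; simp [vecMul, dotProduct, hWi]
    rw [← vecMul_vecMul, hc, sum_vecMul]
    simp only [smul_vecMul]
  have hunit : IsUnit Q.det := by
    rw [isUnit_iff_ne_zero]
    intro hdet
    obtain ⟨c, hc, hcQ⟩ := exists_vecMul_eq_zero_iff.mpr hdet
    apply hc
    funext k
    induction k using WellFoundedGT.induction with
    | ind k ih =>
      obtain ⟨N, hN⟩ := hfac k k.2.le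
      have hck : c ᵥ* (Wiᵀ * H k) = c ᵥ* (Wiᵀ * H 0) := by
        rw [hN, Matrix.mul_sub, ← Matrix.mul_assoc, ← hQB, vecMul_sub, ← vecMul_vecMul c Q, hcQ,
          zero_vecMul, sub_zero]
      have hsum : c ᵥ* (Wiᵀ * H k) = c k • (w k ᵥ* H k) := by
        rw [hWrow]
        refine Finset.sum_eq_single k (fun j _ hjk => ?_) (by simp)
        rcases lt_or_gt_of_ne hjk with h | h
        · rw [hzero k k.2.le j h, smul_zero]
        · rw [ih j h, Pi.zero_apply, zero_smul]
      have hdot : c k * (w k ⬝ᵥ (H k *ᵥ a k)) = 0 := by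
        rw [dotProduct_mulVec, ← smul_eq_mul, ← smul_dotProduct, ← hsum, hck, ← vecMul_vecMul,
          ← dotProduct_mulVec, ← hB, dotProduct_mulVec, vecMul_vecMul, ← hQB, hcQ,
          zero_dotProduct]
      exact (mul_eq_zero.mp hdot).resolve_right (hd2 k k.2)
  refine ⟨hunit, ?_⟩
  obtain ⟨N, hN⟩ := hfac i le_rfl
  have hWH : Wiᵀ * H i = 0 := by
    ext j r
    have := congrFun (hzero i le_rfl j j.2) r
    simpa [Matrix.mul_apply, vecMul, dotProduct, hWi] using this
  have hCN : Wiᵀ * H 0 = Q * N := by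
    rw [hN, Matrix.mul_sub, sub_eq_zero] at hWH
    rw [hWH, hQB, Matrix.mul_assoc Wiᵀ]
  rw [hCN, Matrix.mul_assoc _ Q⁻¹, nonsing_inv_mul_cancel_left _ _ hunit, hN]
end

section
/- Let V be the m×m matrix with columns v₁,…,v_m and W the n×m matrix with columns w₁,…,w_m, and set Q = Vᵀ A H₁ᵀ W. Then the scaled ABS recursions for the Abaffians can be carried out with nonzero denominators wᵢᵀ Hᵢ Aᵀ vᵢ ≠ 0 for all i = 1,…,m if and only if Q is strongly nonsingular, i.e. every leading principal minor of Q (the determinant of its top-left k×k submatrix, k = 1,…,m) is nonzero. -/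
open Matrix

/-- One step of Gaussian elimination on the pivot in the top left corner. -/
theorem det_succ_eq_pivot_mul_det_eliminated {R : Type*} [Field R] {k : ℕ}
    (M : Matrix (Fin (k + 1)) (Fin (k + 1)) R) (h : M 0 0 ≠ 0) :
    M.det = M 0 0 * (Matrix.of fun i j : Fin k =>
      M i.succ j.succ - (M 0 0)⁻¹ * (M i.succ 0 * M 0 j.succ)).det := by
  let c : Fin (k + 1) → R := Fin.cons 0 fun i => (M 0 0)⁻¹ * M i.succ 0
  let B : Matrix (Fin (k + 1)) (Fin (k + 1)) R := Matrix.of fun i j => M i j - c i * M 0 j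
  have hB : M.det = B.det := by
    refine det_eq_of_forall_row_eq_smul_add_const c 0 rfl fun i j => ?_
    simp [B, c]
  have hcol (i : Fin k) : B i.succ 0 = 0 := by
    simp only [B, c, of_apply, Fin.cons_succ]
    field_simp
    ring
  rw [hB, det_succ_column_zero, Fin.sum_univ_succ]
  simp only [hcol, mul_zero, zero_mul, Finset.sum_const_zero, add_zero]
  have h0 : B 0 0 = M 0 0 := by simp [B, c]
  rw [h0]
  simp only [Fin.val_zero, pow_zero, one_mul]
  congr 2
  ext i j
  simp [B, c, mul_assoc]

/-- If `g (l + 1)` arises from `g l` by eliminating with the nonzero pivot `g l l l`, then a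
contiguous principal minor of `g s` starting at `s` is the product of its pivots. -/
theorem det_eq_prod_pivots {R : Type*} [Field R] (g : ℕ → ℕ → ℕ → R) (k s : ℕ)
    (hpivot : ∀ l, l + 1 < s + k → s ≤ l → g l l l ≠ 0)
    (hstep : ∀ l, l + 1 < s + k → s ≤ l → ∀ i j,
      g (l + 1) i j = g l i j - (g l l l)⁻¹ * (g l i l * g l l j)) :
    (Matrix.of fun i j : Fin k => g s (s + i) (s + j)).det =
      ∏ l ∈ Finset.range k, g (s + l) (s + l) (s + l) := by
  induction k generalizing s with
  | zero => simp
  | succ k ih =>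
    rcases Nat.eq_zero_or_pos k with rfl | hk
    · simp
    · rw [det_succ_eq_pivot_mul_det_eliminated _ (by simpa using hpivot s (by omega) le_rfl),
        Finset.prod_range_succ', mul_comm]
      have key := ih (s + 1) (fun l h₁ h₂ => hpivot l (by omega) (by omega))
        (fun l h₁ h₂ => hstep l (by omega) (by omega))
      congr 1
      · simp only [add_assoc, add_comm 1] at key
        rw [← key]
        congr 1
        ext i j
        simp [hstep s (by omega) le_rfl]

/-- The Abaffian update subtracts a rank-one term from the bilinear form of `H`. -/
theorem dotProduct_rankOne_update_mulVec {R n : Type*} [Field R] [Fintype n]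
    (H : Matrix n n R) (c : R) (a b x y : n → R) :
    y ⬝ᵥ ((H - c • vecMulVec (H *ᵥ a) (b ᵥ* H)) *ᵥ x) =
      y ⬝ᵥ (H *ᵥ x) - c * ((b ⬝ᵥ (H *ᵥ x)) * (y ⬝ᵥ (H *ᵥ a))) := by
  rw [sub_mulVec, smul_mulVec, vecMulVec_mulVec, dotProduct_sub, dotProduct_smul,
    ← dotProduct_mulVec]
  simp [dotProduct_smul, mul_comm]

/-- Let `V` be the `m×m` matrix with columns `v₁,…,v_m`, `W`
the `n×m` matrix with columns `w₁,…,w_m`, and `Q = Vᵀ A H₁ᵀ W`. The scaled ABS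
recursions for the Abaffians can be carried out with nonzero denominators
`wᵢᵀ Hᵢ Aᵀ vᵢ ≠ 0` for all `i = 1,…,m` if and only if `Q` is strongly
nonsingular, i.e. every leading principal minor of `Q` is nonzero. -/
theorem abs_admissible_iff_strongly_nonsingular
    {m n : ℕ} (hmn : m ≤ n)
    (A : Matrix (Fin m) (Fin n) ℝ)
    (H₁ : Matrix (Fin n) (Fin n) ℝ) (hH₁ : H₁.det ≠ 0)
    (v : ℕ → Fin m → ℝ) (w : ℕ → Fin n → ℝ)
    (V : Matrix (Fin m) (Fin m) ℝ) (hV : ∀ r c, V r c = v c.1 r)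
    (W : Matrix (Fin n) (Fin m) ℝ) (hW : ∀ r c, W r c = w c.1 r)
    (Q : Matrix (Fin m) (Fin m) ℝ) (hQ : Q = Vᵀ * A * H₁ᵀ * W) :
    (∃ H : ℕ → Matrix (Fin n) (Fin n) ℝ, H 0 = H₁ ∧
      ∀ k < m, w k ⬝ᵥ (H k *ᵥ (Aᵀ *ᵥ v k)) ≠ 0 ∧
        H (k + 1) = H k - (w k ⬝ᵥ (H k *ᵥ (Aᵀ *ᵥ v k)))⁻¹ •
          vecMulVec (H k *ᵥ (Aᵀ *ᵥ v k)) (w k ᵥ* H k)) ↔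
    (∀ k : ℕ, ∀ hk : k ≤ m,
      (Q.submatrix (Fin.castLE hk) (Fin.castLE hk)).det ≠ 0) := by
  have hentry (i j : Fin m) : Q i j = w j ⬝ᵥ (H₁ *ᵥ (Aᵀ *ᵥ v i)) := by
    have hVi : Vᵀ i = v i := funext fun r => hV r i
    have hWj : Wᵀ j = w j := funext fun r => hW r j
    have hrow : (Vᵀ * A * H₁ᵀ) i = H₁ *ᵥ (Aᵀ *ᵥ v i) := by
      rw [mul_apply_eq_vecMul, mul_apply_eq_vecMul, hVi, vecMul_transpose, mulVec_transpose]
    rw [hQ, ← hrow, ← hWj, dotProduct_comm]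
    rfl
  have hdet (H : ℕ → Matrix (Fin n) (Fin n) ℝ) (h0 : H 0 = H₁) (k : ℕ) (hk : k ≤ m)
      (hH : ∀ l, l + 1 < k → w l ⬝ᵥ (H l *ᵥ (Aᵀ *ᵥ v l)) ≠ 0 ∧
        H (l + 1) = H l - (w l ⬝ᵥ (H l *ᵥ (Aᵀ *ᵥ v l)))⁻¹ •
          vecMulVec (H l *ᵥ (Aᵀ *ᵥ v l)) (w l ᵥ* H l)) :
      (Q.submatrix (Fin.castLE hk) (Fin.castLE hk)).det =
        ∏ l ∈ Finset.range k, w l ⬝ᵥ (H l *ᵥ (Aᵀ *ᵥ v l)) := by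
    have key := det_eq_prod_pivots (fun l i j => w j ⬝ᵥ (H l *ᵥ (Aᵀ *ᵥ v i))) k 0
      (fun l hl _ => (hH l (by omega)).1) (fun l hl _ i j => by
        rw [(hH l (by omega)).2, dotProduct_rankOne_update_mulVec])
    simp only [zero_add] at key
    rw [← key]
    congr 1
    ext i j
    simp [hentry, h0]
  constructor
  · rintro ⟨H, h0, hH⟩ k hk
    rw [hdet H h0 k hk fun l hl => hH l (by omega), Finset.prod_ne_zero_iff]
    exact fun l hl => (hH l ((Finset.mem_range.1 hl).trans_le hk)).1
  · intro hminor
    let H : ℕ → Matrix (Fin n) (Fin n) ℝ := fun k => Nat.rec H₁ (fun l Hl =>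
      Hl - (w l ⬝ᵥ (Hl *ᵥ (Aᵀ *ᵥ v l)))⁻¹ • vecMulVec (Hl *ᵥ (Aᵀ *ᵥ v l)) (w l ᵥ* Hl)) k
    refine ⟨H, rfl, fun k hk => ⟨?_, rfl⟩⟩
    induction k using Nat.strong_induction_on with
    | _ k ih =>
      have hne := hminor (k + 1) hk
      rw [hdet H rfl (k + 1) hk fun l hl => ⟨ih l (by omega) (by omega), rfl⟩,
        Finset.prod_ne_zero_iff] at hne
      exact hne k (Finset.self_mem_range_succ k)
end

section
/- In the conjugate direction subclass of the scaled ABS class, obtained by the choice vᵢ = pᵢ with m = n and A symmetric positive definite, if the recursions are carried out with nonzero denominators through step i, then the search directions are A-conjugate: pⱼᵀ A p_k = 0 for all 1 ≤ j < k ≤ i. -/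
open Matrix

/-- Applying the rank-one update `M - (w ⬝ᵥ M v)⁻¹ • (M v) (wᵀ M)` to a vector `u`. -/
theorem rankOne_update_mulVec {m ι : Type*} [Fintype m] [Fintype ι]
    (M : Matrix m ι ℝ) (w : m → ℝ) (u v : ι → ℝ) :
    (M - (w ⬝ᵥ (M *ᵥ v))⁻¹ • vecMulVec (M *ᵥ v) (w ᵥ* M)) *ᵥ u =
      M *ᵥ u - ((w ⬝ᵥ (M *ᵥ v))⁻¹ * (w ⬝ᵥ (M *ᵥ u))) • (M *ᵥ v) := by
  rw [sub_mulVec, smul_mulVec, vecMulVec_mulVec, ← dotProduct_mulVec, op_smul_eq_smul, smul_smul]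

/-- The rank-one updates send every previously used vector to zero. -/
theorem rankOne_update_mulVec_eq_zero {m ι : Type*} [Fintype m] [Fintype ι]
    (H : ℕ → Matrix m ι ℝ) (w : ℕ → m → ℝ) (v : ℕ → ι → ℝ) (i : ℕ)
    (hd : ∀ k < i, w k ⬝ᵥ (H k *ᵥ v k) ≠ 0)
    (hH : ∀ k < i, H (k + 1) =
      H k - (w k ⬝ᵥ (H k *ᵥ v k))⁻¹ • vecMulVec (H k *ᵥ v k) (w k ᵥ* H k))
    {j k : ℕ} (hjk : j < k) (hk : k ≤ i) : H k *ᵥ v j = 0 := by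
  induction k, hjk using Nat.le_induction with
  | base => rw [hH j hk, rankOne_update_mulVec, inv_mul_cancel₀ (hd j hk), one_smul, sub_self]
  | succ k _ ih =>
    rw [hH k hk, rankOne_update_mulVec, ih (Nat.le_of_succ_le hk)]
    simp

/-- In the conjugate direction subclass of the scaled ABS
class (`vᵢ = pᵢ`, `m = n`, `A` symmetric positive definite), if the recursions
are carried out with nonzero denominators through step `i`, then the search
directions are `A`-conjugate: `pⱼᵀ A p_k = 0` for all `1 ≤ j < k ≤ i`
(here `j < k < i`, 0-based). -/
theorem abs_conjugate_direction_subclass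
    {n : ℕ}
    (A : Matrix (Fin n) (Fin n) ℝ) (b : Fin n → ℝ)
    (hA : A.PosDef)
    (H : ℕ → Matrix (Fin n) (Fin n) ℝ) (x : ℕ → Fin n → ℝ)
    (z w : ℕ → Fin n → ℝ)
    (p : ℕ → Fin n → ℝ) (α : ℕ → ℝ)
    (hH1 : (H 0).det ≠ 0)
    (i : ℕ) (hi : i ≤ n)
    (hp : ∀ k < i, p k = (H k)ᵀ *ᵥ z k)
    (hα : ∀ k < i, α k = (p k ⬝ᵥ (A *ᵥ x k - b)) / (p k ⬝ᵥ (A *ᵥ p k)))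
    (hx : ∀ k < i, x (k + 1) = x k - α k • p k)
    (hd1 : ∀ k < i, p k ⬝ᵥ (A *ᵥ p k) ≠ 0)
    (hd2 : ∀ k < i, w k ⬝ᵥ (H k *ᵥ (Aᵀ *ᵥ p k)) ≠ 0)
    (hH : ∀ k < i, H (k + 1) =
      H k - (w k ⬝ᵥ (H k *ᵥ (Aᵀ *ᵥ p k)))⁻¹ •
        vecMulVec (H k *ᵥ (Aᵀ *ᵥ p k)) (w k ᵥ* H k)) :
    ∀ j k : ℕ, j < k → k < i → p j ⬝ᵥ (A *ᵥ p k) = 0 := by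
  intro j k hjk hk
  have hzero := rankOne_update_mulVec_eq_zero H w (fun l => Aᵀ *ᵥ p l) i hd2 hH hjk hk.le
  rw [dotProduct_mulVec, ← mulVec_transpose, hp k hk, dotProduct_mulVec, vecMul_transpose, hzero,
    zero_dotProduct]
end

section
/- In the orthogonally scaled subclass of the scaled ABS class, obtained by the choice vᵢ = A pᵢ, if the recursions are carried out with nonzero denominators through step i, then the scaling vectors are mutually orthogonal and the search directions are AᵀA-conjugate: (A pⱼ)ᵀ (A p_k) = pⱼᵀ Aᵀ A p_k = 0 for all 1 ≤ j < k ≤ i. -/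
open Matrix

namespace Matrix

/-- The ABS update of `H` along `u` and `w`, applied to a vector `v`. -/
theorem sub_smul_vecMulVec_mulVec {ι κ R : Type*} [Fintype κ] [Fintype ι] [CommRing R]
    (H : Matrix ι κ R) (u v : κ → R) (w : ι → R) (c : R) :
    (H - c • vecMulVec (H *ᵥ u) (w ᵥ* H)) *ᵥ v =
      H *ᵥ v - (c * (w ⬝ᵥ (H *ᵥ v))) • (H *ᵥ u) := by
  rw [sub_mulVec, smul_mulVec, vecMulVec_mulVec, ← dotProduct_mulVec, op_smul_eq_smul, smul_smul]

/-- The iterated ABS updates of `H` annihilate every vector already processed. -/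
theorem abs_update_mulVec_eq_zero {n K : Type*} [Fintype n] [Field K]
    (H : ℕ → Matrix n n K) (u w : ℕ → n → K) (i : ℕ)
    (hd : ∀ k < i, w k ⬝ᵥ (H k *ᵥ u k) ≠ 0)
    (hH : ∀ k < i, H (k + 1) =
      H k - (w k ⬝ᵥ (H k *ᵥ u k))⁻¹ • vecMulVec (H k *ᵥ u k) (w k ᵥ* H k))
    {j k : ℕ} (hjk : j < k) (hki : k ≤ i) : H k *ᵥ u j = 0 := by
  induction k, hjk using Nat.le_induction with
  | base =>
    rw [hH j hki, sub_smul_vecMulVec_mulVec, inv_mul_cancel₀ (hd j hki), one_smul, sub_self]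
  | succ k _ ih =>
    rw [hH k hki, sub_smul_vecMulVec_mulVec, ih (Nat.le_of_succ_le hki)]
    simp

end Matrix

/-- In the orthogonally scaled subclass of the scaled ABS
class (`vᵢ = A pᵢ`, `A` of full column rank), if the recursions are carried
out with nonzero denominators through step `i`, then the scaling vectors are
mutually orthogonal and the search directions are `AᵀA`-conjugate:
`(A pⱼ) ⬝ᵥ (A p_k) = 0` for all `1 ≤ j < k ≤ i` (here `j < k < i`, 0-based). -/
theorem abs_orthogonally_scaled_subclass
    {m n : ℕ}
    (A : Matrix (Fin m) (Fin n) ℝ) (b : Fin m → ℝ)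
    (hrank : A.rank = n)
    (H : ℕ → Matrix (Fin n) (Fin n) ℝ) (x : ℕ → Fin n → ℝ)
    (z w : ℕ → Fin n → ℝ)
    (p : ℕ → Fin n → ℝ) (α : ℕ → ℝ)
    (hH1 : (H 0).det ≠ 0)
    (i : ℕ)
    (hp : ∀ k < i, p k = (H k)ᵀ *ᵥ z k)
    (hα : ∀ k < i, α k = ((A *ᵥ p k) ⬝ᵥ (A *ᵥ x k - b)) / ((A *ᵥ p k) ⬝ᵥ (A *ᵥ p k)))
    (hx : ∀ k < i, x (k + 1) = x k - α k • p k)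
    (hd1 : ∀ k < i, (A *ᵥ p k) ⬝ᵥ (A *ᵥ p k) ≠ 0)
    (hd2 : ∀ k < i, w k ⬝ᵥ (H k *ᵥ (Aᵀ *ᵥ (A *ᵥ p k))) ≠ 0)
    (hH : ∀ k < i, H (k + 1) =
      H k - (w k ⬝ᵥ (H k *ᵥ (Aᵀ *ᵥ (A *ᵥ p k))))⁻¹ •
        vecMulVec (H k *ᵥ (Aᵀ *ᵥ (A *ᵥ p k))) (w k ᵥ* H k)) :
    ∀ j k : ℕ, j < k → k < i → (A *ᵥ p j) ⬝ᵥ (A *ᵥ p k) = 0 := by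
  intro j k hjk hki
  have h := abs_update_mulVec_eq_zero H (fun k => Aᵀ *ᵥ (A *ᵥ p k)) w i hd2 hH hjk hki.le
  rw [dotProduct_mulVec, ← mulVec_transpose, hp k hki, dotProduct_mulVec, vecMul_transpose, h,
    zero_dotProduct]
end

section
/- In the Huang method, if the rows a₁,…,a_i of A are linearly independent (so the recursions are well defined through step i), then the search vectors are mutually orthogonal: pⱼᵀ p_k = 0 for all 1 ≤ j < k ≤ i. -/
open Matrix

/-- One step of the Huang update of the matrix `H` along the vector `a`. -/
noncomputable def huangStep {ι : Type*} [Fintype ι] (H : Matrix ι ι ℝ) (a : ι → ℝ) :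
    Matrix ι ι ℝ :=
  H - (a ⬝ᵥ (H *ᵥ a))⁻¹ • vecMulVec (H *ᵥ a) (a ᵥ* H)

section HuangStep

variable {ι : Type*} [Fintype ι] {H : Matrix ι ι ℝ}

theorem vecMul_eq_mulVec_of_isSymm (hs : H.IsSymm) (a : ι → ℝ) : a ᵥ* H = H *ᵥ a := by
  rw [← mulVec_transpose, hs.eq]

theorem dotProduct_mulVec_self_of_isSymm_of_isIdempotentElem (hs : H.IsSymm)
    (hi : IsIdempotentElem H) (a : ι → ℝ) :
    a ⬝ᵥ (H *ᵥ a) = (H *ᵥ a) ⬝ᵥ (H *ᵥ a) := by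
  conv_rhs =>
    rw [dotProduct_mulVec, vecMul_eq_mulVec_of_isSymm hs, mulVec_mulVec, hi.eq, dotProduct_comm]

theorem huangStep_eq (hs : H.IsSymm) (hi : IsIdempotentElem H) (a : ι → ℝ) :
    huangStep H a =
      H - ((H *ᵥ a) ⬝ᵥ (H *ᵥ a))⁻¹ • vecMulVec (H *ᵥ a) (H *ᵥ a) := by
  rw [huangStep, dotProduct_mulVec_self_of_isSymm_of_isIdempotentElem hs hi,
    vecMul_eq_mulVec_of_isSymm hs]

theorem huangStep_isSymm (hs : H.IsSymm) (hi : IsIdempotentElem H) (a : ι → ℝ) :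
    (huangStep H a).IsSymm := by
  rw [huangStep_eq hs hi, IsSymm, transpose_sub, transpose_smul, transpose_vecMulVec, hs.eq]

theorem huangStep_isIdempotentElem (hs : H.IsSymm) (hi : IsIdempotentElem H) (a : ι → ℝ) :
    IsIdempotentElem (huangStep H a) := by
  have hHp : H *ᵥ (H *ᵥ a) = H *ᵥ a := by rw [mulVec_mulVec, hi.eq]
  have hc (x : ℝ) : x⁻¹ * (x⁻¹ * x) = x⁻¹ := by
    rcases eq_or_ne x 0 with rfl | hx
    · simp
    · rw [inv_mul_cancel₀ hx, mul_one]
  rw [huangStep_eq hs hi]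
  generalize H *ᵥ a = p at hHp
  rw [IsIdempotentElem, sub_mul, mul_sub, mul_sub, hi.eq, mul_smul_comm, smul_mul_assoc,
    smul_mul_assoc, mul_smul_comm, mul_vecMulVec, vecMulVec_mul, vecMul_eq_mulVec_of_isSymm hs, hHp, vecMulVec_mul_vecMulVec,
    vecMulVec_smul, smul_smul, smul_smul, mul_assoc, hc, sub_self, sub_zero]

theorem huangStep_mulVec_mulVec_self (hs : H.IsSymm) (hi : IsIdempotentElem H) (a : ι → ℝ) :
    huangStep H a *ᵥ (H *ᵥ a) = 0 := by
  have hHp : H *ᵥ (H *ᵥ a) = H *ᵥ a := by rw [mulVec_mulVec, hi.eq]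
  rw [huangStep_eq hs hi, sub_mulVec, hHp, smul_mulVec, vecMulVec_mulVec, op_smul_eq_smul,
    smul_smul]
  rcases eq_or_ne (H *ᵥ a) 0 with h | h
  · simp [h]
  · rw [inv_mul_cancel₀ (by rwa [Ne, dotProduct_self_eq_zero]), one_smul, sub_self]

theorem huangStep_mulVec_eq_zero (a : ι → ℝ) {v : ι → ℝ} (hv : H *ᵥ v = 0) :
    huangStep H a *ᵥ v = 0 := by
  rw [huangStep, sub_mulVec, hv, smul_mulVec, vecMulVec_mulVec, ← dotProduct_mulVec, hv]
  simp

end HuangStep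

/-- In the Huang method (`H₁ = I`, `zᵢ = wᵢ = aᵢ`,
`vᵢ = eᵢ`), if the rows `a₁,…,a_i` of `A` are linearly independent (so the
recursions are well defined through step `i`), then the search vectors are
mutually orthogonal: `pⱼᵀ p_k = 0` for all `1 ≤ j < k ≤ i`
(here `j < k < i`, 0-based). -/
theorem huang_search_vectors_orthogonal
    {m n : ℕ}
    (A : Matrix (Fin m) (Fin n) ℝ)
    (H : ℕ → Matrix (Fin n) (Fin n) ℝ)
    (p : ℕ → Fin n → ℝ)
    (hH0 : H 0 = 1)
    (i : ℕ) (him : i ≤ m)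
    (hlin : LinearIndependent ℝ (fun j : Fin i => A (Fin.castLE him j)))
    (hp : ∀ k, ∀ hk : k < i, p k = (H k)ᵀ *ᵥ A ⟨k, hk.trans_le him⟩)
    (hH : ∀ k, ∀ hk : k < i, H (k + 1) =
      H k - (A ⟨k, hk.trans_le him⟩ ⬝ᵥ (H k *ᵥ A ⟨k, hk.trans_le him⟩))⁻¹ •
        vecMulVec (H k *ᵥ A ⟨k, hk.trans_le him⟩) (A ⟨k, hk.trans_le him⟩ ᵥ* H k)) :
    ∀ j k : ℕ, j < k → k < i → p j ⬝ᵥ p k = 0 := by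
  have hinv : ∀ k ≤ i, (H k).IsSymm ∧ IsIdempotentElem (H k) ∧
      ∀ j < k, H k *ᵥ p j = 0 := by
    intro k
    induction k with
    | zero =>
      intro _
      rw [hH0]
      exact ⟨isSymm_one, IsIdempotentElem.one, fun j hj => absurd hj j.not_lt_zero⟩
    | succ k ih =>
      intro hk
      obtain ⟨hs, hi, horth⟩ := ih (Nat.le_of_succ_le hk)
      have hstep : H (k + 1) = huangStep (H k) (A ⟨k, Nat.lt_of_lt_of_le hk him⟩) := hH k hk
      rw [hstep]
      refine ⟨huangStep_isSymm hs hi _, huangStep_isIdempotentElem hs hi _, fun j hj => ?_⟩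
      rcases Nat.lt_succ_iff_lt_or_eq.mp hj with hj | rfl
      · exact huangStep_mulVec_eq_zero _ (horth j hj)
      · rw [hp j hk, hs.eq]
        exact huangStep_mulVec_mulVec_self hs hi _
  intro j k hjk hk
  obtain ⟨hs, -, horth⟩ := hinv k hk.le
  rw [hp k hk, hs.eq, dotProduct_mulVec, vecMul_eq_mulVec_of_isSymm hs, horth j hjk,
    zero_dotProduct]
end

section
/- In the Huang method, if the rows a₁,…,a_i of A are linearly independent (so the recursions are well defined through step i), then every Abaffian H_j for j ≤ i+1 is symmetric and idempotent: Hⱼᵀ = Hⱼ and Hⱼ² = Hⱼ; in particular Hⱼ(Hⱼ q) = Hⱼ q for every q ∈ ℝⁿ. -/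
open Matrix

/-- The rank-one update of the Huang method preserves symmetric idempotents. When the pivot
`a ⬝ᵥ (P *ᵥ a)` vanishes, `0⁻¹ = 0` makes the update trivial. -/
theorem symmetric_idempotent_sub_rankOne {ι : Type*} [Fintype ι]
    {P : Matrix ι ι ℝ} (hs : Pᵀ = P) (hp : P * P = P) (a : ι → ℝ) :
    (P - (a ⬝ᵥ (P *ᵥ a))⁻¹ • vecMulVec (P *ᵥ a) (a ᵥ* P))ᵀ =
        P - (a ⬝ᵥ (P *ᵥ a))⁻¹ • vecMulVec (P *ᵥ a) (a ᵥ* P) ∧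
      (P - (a ⬝ᵥ (P *ᵥ a))⁻¹ • vecMulVec (P *ᵥ a) (a ᵥ* P)) *
          (P - (a ⬝ᵥ (P *ᵥ a))⁻¹ • vecMulVec (P *ᵥ a) (a ᵥ* P)) =
        P - (a ⬝ᵥ (P *ᵥ a))⁻¹ • vecMulVec (P *ᵥ a) (a ᵥ* P) := by
  have hv : a ᵥ* P = P *ᵥ a := by
    rw [← mulVec_transpose, hs]
  have hPu : P *ᵥ (P *ᵥ a) = P *ᵥ a := by
    rw [mulVec_mulVec, hp]
  have huP : (P *ᵥ a) ᵥ* P = P *ᵥ a := by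
    rw [← mulVec_transpose, hs, hPu]
  have huu : (P *ᵥ a) ⬝ᵥ (P *ᵥ a) = a ⬝ᵥ (P *ᵥ a) := by
    rw [dotProduct_mulVec, huP, dotProduct_comm]
  rw [hv]
  generalize P *ᵥ a = u at *
  generalize a ⬝ᵥ u = c at *
  refine ⟨by rw [transpose_sub, transpose_smul, transpose_vecMulVec, hs], ?_⟩
  have hc : c⁻¹ * c⁻¹ * c = c⁻¹ := by
    rcases eq_or_ne c 0 with rfl | h
    · simp
    · rw [mul_assoc, inv_mul_cancel₀ h, mul_one]
  have huuT : vecMulVec u u * vecMulVec u u = c • vecMulVec u u := by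
    rw [vecMulVec_mul_vecMulVec, huu, vecMulVec_smul]
  rw [sub_mul, mul_sub, mul_sub, hp, smul_mul_assoc, mul_smul_comm, smul_mul_assoc,
    mul_smul_comm, mul_vecMulVec, vecMulVec_mul, hPu, huP, huuT, smul_smul, smul_smul, hc]
  simp

/-- In the Huang method, if the rows `a₁,…,a_i` of `A` are
linearly independent (so the recursions are well defined through step `i`),
then every Abaffian `H_j` for `j ≤ i+1` (here `H j`, `j ≤ i`, 0-based) is
symmetric and idempotent: `Hⱼᵀ = Hⱼ` and `Hⱼ² = Hⱼ`; in particular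
`Hⱼ(Hⱼ q) = Hⱼ q` for every `q ∈ ℝⁿ`. -/
theorem huang_abaffians_symmetric_idempotent
    {m n : ℕ}
    (A : Matrix (Fin m) (Fin n) ℝ)
    (H : ℕ → Matrix (Fin n) (Fin n) ℝ)
    (hH0 : H 0 = 1)
    (i : ℕ) (him : i ≤ m)
    (hlin : LinearIndependent ℝ (fun j : Fin i => A (Fin.castLE him j)))
    (hH : ∀ k, ∀ hk : k < i, H (k + 1) =
      H k - (A ⟨k, hk.trans_le him⟩ ⬝ᵥ (H k *ᵥ A ⟨k, hk.trans_le him⟩))⁻¹ •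
        vecMulVec (H k *ᵥ A ⟨k, hk.trans_le him⟩) (A ⟨k, hk.trans_le him⟩ ᵥ* H k)) :
    ∀ j ≤ i, (H j)ᵀ = H j ∧ H j * H j = H j ∧
      ∀ q : Fin n → ℝ, H j *ᵥ (H j *ᵥ q) = H j *ᵥ q := by
  suffices h : ∀ j ≤ i, (H j)ᵀ = H j ∧ H j * H j = H j by
    intro j hj
    obtain ⟨hs, hp⟩ := h j hj
    exact ⟨hs, hp, fun q => by rw [mulVec_mulVec, hp]⟩
  intro j
  induction j with
  | zero => simp [hH0]
  | succ k ih =>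
    intro hk
    obtain ⟨hs, hp⟩ := ih (Nat.le_of_succ_le hk)
    rw [hH k hk]
    exact symmetric_idempotent_sub_rankOne hs hp _
end

section
/- In the Huang method started from x₁ = 0, if the rows a₁,…,a_i of A are linearly independent (so the recursions are well defined through step i), then x_{i+1} is the least Euclidean norm solution of the first i equations: aⱼᵀ x_{i+1} = bⱼ for j = 1,…,i, and for every x ∈ ℝⁿ with aⱼᵀ x = bⱼ for j = 1,…,i one has ‖x_{i+1}‖₂ ≤ ‖x‖₂. -/
open Matrix

/-- The Huang update `H - H a aᵀ H / (aᵀ H a)`. -/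
noncomputable def huangUpdate {n : Type*} [Fintype n] (H : Matrix n n ℝ) (a : n → ℝ) : Matrix n n ℝ :=
  H - (a ⬝ᵥ (H *ᵥ a))⁻¹ • vecMulVec (H *ᵥ a) (a ᵥ* H)

section HuangUpdate

variable {n : Type*} [Fintype n] {H : Matrix n n ℝ} {a : n → ℝ}

theorem huangUpdate_mulVec (v : n → ℝ) :
    huangUpdate H a *ᵥ v =
      H *ᵥ v - ((a ⬝ᵥ (H *ᵥ a))⁻¹ * (a ⬝ᵥ (H *ᵥ v))) • (H *ᵥ a) := by
  rw [huangUpdate, sub_mulVec, smul_mulVec, vecMulVec_mulVec, ← dotProduct_mulVec,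
    op_smul_eq_smul, smul_smul]

theorem huangUpdate_isSymm (hs : H.IsSymm) : (huangUpdate H a).IsSymm := by
  have h : a ᵥ* H = H *ᵥ a := by rw [← mulVec_transpose, hs.eq]
  rw [Matrix.IsSymm, huangUpdate, h, transpose_sub, transpose_smul, transpose_vecMulVec, hs.eq]

theorem dotProduct_mulVec_self_of_isSymm (hs : H.IsSymm) (hi : IsIdempotentElem H) :
    a ⬝ᵥ (H *ᵥ a) = (H *ᵥ a) ⬝ᵥ (H *ᵥ a) := by
  conv_lhs => rw [← hi.eq, ← mulVec_mulVec, dotProduct_mulVec, ← mulVec_transpose, hs.eq]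

theorem huangUpdate_isIdempotentElem (hi : IsIdempotentElem H)
    (ha : a ⬝ᵥ (H *ᵥ a) ≠ 0) : IsIdempotentElem (huangUpdate H a) := by
  have hH (v : n → ℝ) : H *ᵥ (H *ᵥ v) = H *ᵥ v := by rw [mulVec_mulVec, hi.eq]
  classical
  refine Matrix.ext_of_mulVec_single fun j => ?_
  rw [← mulVec_mulVec]
  generalize (Pi.single j 1 : n → ℝ) = v
  simp only [huangUpdate_mulVec, mulVec_sub, mulVec_smul, hH]
  field_simp
  simp

theorem huangUpdate_mulVec_self (ha : a ⬝ᵥ (H *ᵥ a) ≠ 0) : huangUpdate H a *ᵥ a = 0 := by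
  rw [huangUpdate_mulVec, inv_mul_cancel₀ ha, one_smul, sub_self]

theorem huangUpdate_mulVec_eq_zero {v : n → ℝ} (hv : H *ᵥ v = 0) :
    huangUpdate H a *ᵥ v = 0 := by
  simp [huangUpdate_mulVec, hv]

/-- A vector orthogonal to a spanning set of a submodule is orthogonal to the submodule. -/
theorem dotProduct_eq_zero_of_mem_span {s : Set (n → ℝ)} {v w : n → ℝ}
    (hw : w ∈ Submodule.span ℝ s) (h : ∀ u ∈ s, u ⬝ᵥ v = 0) : w ⬝ᵥ v = 0 := by
  induction hw using Submodule.span_induction with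
  | mem u hu => exact h u hu
  | zero => exact zero_dotProduct v
  | add u w _ _ hu hw => rw [add_dotProduct, hu, hw, add_zero]
  | smul c u _ hu => rw [smul_dotProduct, hu, smul_zero]

end HuangUpdate

/-- The state of the Huang recursion after `k` steps: `H` is the orthogonal projection onto the
complement of the first `k` rows, and `x` is the solution of the first `k` equations lying in
the span of these rows. -/
structure HuangInvariant {n : Type*} [Fintype n] [DecidableEq n] {i : ℕ} (f : Fin i → n → ℝ)
    (c : Fin i → ℝ) (k : ℕ) (H : Matrix n n ℝ) (x : n → ℝ) : Prop where
  isSymm : H.IsSymm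
  isIdempotentElem : IsIdempotentElem H
  mulVec_eq_zero : ∀ j : Fin i, j.val < k → H *ᵥ f j = 0
  sub_mem : ∀ v, v - H *ᵥ v ∈ Submodule.span ℝ (f '' {j | j.val < k})
  mem : x ∈ Submodule.span ℝ (f '' {j | j.val < k})
  solves : ∀ j : Fin i, j.val < k → f j ⬝ᵥ x = c j

namespace HuangInvariant

variable {n : Type*} [Fintype n] [DecidableEq n] {i : ℕ} {f : Fin i → n → ℝ} {c : Fin i → ℝ}

theorem zero : HuangInvariant f c 0 1 0 where
  isSymm := isSymm_one
  isIdempotentElem := IsIdempotentElem.one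
  mulVec_eq_zero := by simp
  sub_mem := by simp
  mem := Submodule.zero_mem _
  solves := by simp

theorem succ (hf : LinearIndependent ℝ f) {k : Fin i} {H : Matrix n n ℝ} {x : n → ℝ}
    (h : HuangInvariant f c k.val H x) :
    HuangInvariant f c (k.val + 1) (huangUpdate H (f k))
      (x - ((f k ⬝ᵥ x - c k) / (f k ⬝ᵥ (H *ᵥ f k))) • (H *ᵥ f k)) := by
  have hne : f k ⬝ᵥ (H *ᵥ f k) ≠ 0 := by
    rw [dotProduct_mulVec_self_of_isSymm h.isSymm h.isIdempotentElem]
    intro h0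
    have hmem := h.sub_mem (f k)
    rw [dotProduct_self_eq_zero.mp h0, sub_zero] at hmem
    exact hf.notMem_span_image (s := {j | j.val < k.val}) (by simp) hmem
  have hle : Submodule.span ℝ (f '' {j | j.val < k.val}) ≤
      Submodule.span ℝ (f '' {j | j.val < k.val + 1}) :=
    Submodule.span_mono (Set.image_mono fun j hj => Nat.lt_succ_of_lt hj)
  have hHk : H *ᵥ f k ∈ Submodule.span ℝ (f '' {j | j.val < k.val + 1}) := by
    rw [← sub_sub_cancel (f k) (H *ᵥ f k)]
    exact Submodule.sub_mem _ (Submodule.subset_span ⟨k, Nat.lt_succ_self _, rfl⟩)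
      (hle (h.sub_mem _))
  refine ⟨huangUpdate_isSymm h.isSymm,
    huangUpdate_isIdempotentElem h.isIdempotentElem hne, fun j hj => ?_, fun v => ?_,
    Submodule.sub_mem _ (hle h.mem) (Submodule.smul_mem _ _ hHk), fun j hj => ?_⟩
  · rcases Nat.lt_succ_iff_lt_or_eq.mp hj with hj | hj
    · exact huangUpdate_mulVec_eq_zero (h.mulVec_eq_zero j hj)
    · rw [Fin.ext hj]
      exact huangUpdate_mulVec_self hne
  · rw [huangUpdate_mulVec, ← sub_add]
    exact Submodule.add_mem _ (hle (h.sub_mem v)) (Submodule.smul_mem _ _ hHk)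
  · rw [dotProduct_sub, dotProduct_smul, smul_eq_mul]
    rcases Nat.lt_succ_iff_lt_or_eq.mp hj with hj | hj
    · have horth : f j ⬝ᵥ (H *ᵥ f k) = 0 := by
        rw [dotProduct_mulVec, ← mulVec_transpose, h.isSymm.eq, h.mulVec_eq_zero j hj,
          zero_dotProduct]
      rw [horth, mul_zero, sub_zero, h.solves j hj]
    · rw [Fin.ext hj, div_mul_cancel₀ _ hne, sub_sub_cancel]

theorem dotProduct_self_le {k : ℕ} {H : Matrix n n ℝ} {x y : n → ℝ}
    (h : HuangInvariant f c k H x) (hy : ∀ j : Fin i, j.val < k → f j ⬝ᵥ y = c j) :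
    x ⬝ᵥ x ≤ y ⬝ᵥ y := by
  have horth : x ⬝ᵥ (y - x) = 0 := by
    refine dotProduct_eq_zero_of_mem_span h.mem ?_
    rintro _ ⟨j, hj, rfl⟩
    rw [dotProduct_sub, hy j hj, h.solves j hj, sub_self]
  have hnonneg : 0 ≤ (y - x) ⬝ᵥ (y - x) := Finset.sum_nonneg fun t _ => mul_self_nonneg _
  simp only [dotProduct_sub, sub_dotProduct, dotProduct_comm y x] at horth hnonneg
  linarith

end HuangInvariant

/-- In the Huang method started from `x₁ = 0` (here
`x 0 = 0`), if the rows `a₁,…,a_i` of `A` are linearly independent (so the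
recursions are well defined through step `i`), then `x_{i+1}` (here `x i`) is
the least Euclidean norm solution of the first `i` equations: `aⱼᵀ x_{i+1} = bⱼ`
for `j = 1,…,i`, and for every `y ∈ ℝⁿ` with `aⱼᵀ y = bⱼ` for `j = 1,…,i` one
has `‖x_{i+1}‖₂ ≤ ‖y‖₂`. -/
theorem huang_least_norm_solution
    {m n : ℕ}
    (A : Matrix (Fin m) (Fin n) ℝ) (b : Fin m → ℝ)
    (H : ℕ → Matrix (Fin n) (Fin n) ℝ) (x : ℕ → Fin n → ℝ)
    (p : ℕ → Fin n → ℝ) (α : ℕ → ℝ)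
    (hH0 : H 0 = 1) (hx0 : x 0 = 0)
    (i : ℕ) (him : i ≤ m)
    (hlin : LinearIndependent ℝ (fun j : Fin i => A (Fin.castLE him j)))
    (hp : ∀ k, ∀ hk : k < i, p k = (H k)ᵀ *ᵥ A ⟨k, hk.trans_le him⟩)
    (hα : ∀ k, ∀ hk : k < i, α k =
      (A *ᵥ x k - b) ⟨k, hk.trans_le him⟩ / (A ⟨k, hk.trans_le him⟩ ⬝ᵥ p k))
    (hx : ∀ k < i, x (k + 1) = x k - α k • p k)
    (hH : ∀ k, ∀ hk : k < i, H (k + 1) =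
      H k - (A ⟨k, hk.trans_le him⟩ ⬝ᵥ (H k *ᵥ A ⟨k, hk.trans_le him⟩))⁻¹ •
        vecMulVec (H k *ᵥ A ⟨k, hk.trans_le him⟩) (A ⟨k, hk.trans_le him⟩ ᵥ* H k)) :
    (∀ j, ∀ hj : j < i, A ⟨j, hj.trans_le him⟩ ⬝ᵥ x i = b ⟨j, hj.trans_le him⟩) ∧
    ∀ y : Fin n → ℝ,
      (∀ j, ∀ hj : j < i, A ⟨j, hj.trans_le him⟩ ⬝ᵥ y = b ⟨j, hj.trans_le him⟩) →
      Real.sqrt (∑ t, x i t ^ 2) ≤ Real.sqrt (∑ t, y t ^ 2) := by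
  have hinv : ∀ k ≤ i, HuangInvariant (fun j : Fin i => A (Fin.castLE him j))
      (fun j => b (Fin.castLE him j)) k (H k) (x k) := by
    intro k
    induction k with
    | zero => exact fun _ => hH0 ▸ hx0 ▸ HuangInvariant.zero
    | succ k ih =>
      intro hk
      have h := ih (Nat.le_of_succ_le hk)
      rw [hx k hk, hα k hk, hp k hk, h.isSymm.eq, hH k hk]
      exact HuangInvariant.succ hlin (k := ⟨k, hk⟩) h
  have h := hinv i le_rfl
  refine ⟨fun j hj => h.solves ⟨j, hj⟩ hj, fun y hy => Real.sqrt_le_sqrt ?_⟩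
  simpa only [dotProduct, ← sq] using h.dotProduct_self_le fun j hj => hy j hj
end

section
/- In the implicit LU method, carried out with nonzero denominators through step i, the Abaffian H_{i+1} has the block structure (13): its first i rows are zero, and its trailing principal (n−i)×(n−i) block is the identity; equivalently, eⱼᵀ H_{i+1} = 0 for 1 ≤ j ≤ i and e_kᵀ H_{i+1} e_l = δ_{kl} for i < k, l ≤ n. Consequently the last n−i components of pᵢ are zero and the i-th component of pᵢ equals one. -/
open Matrix

/-- One Abaffian update at pivot `m` kills row `m`, keeps zero rows zero, and preserves the identity
in the trailing block past `m`. -/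
theorem Matrix.abaffian_update_structure {n : ℕ} {K : Type*} [Field K]
    (H : Matrix (Fin n) (Fin n) K) (a : Fin n → K) (m : Fin n)
    (hd : Pi.single m 1 ⬝ᵥ (H *ᵥ a) ≠ 0)
    (hzero : ∀ j c : Fin n, j < m → H j c = 0)
    (hone : ∀ k l : Fin n, m ≤ k → m ≤ l → H k l = if k = l then 1 else 0) :
    let H' := H - (Pi.single m 1 ⬝ᵥ (H *ᵥ a))⁻¹ •
      vecMulVec (H *ᵥ a) (Pi.single m 1 ᵥ* H)
    (∀ j c : Fin n, j ≤ m → H' j c = 0) ∧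
      ∀ k l : Fin n, m < k → m < l → H' k l = if k = l then 1 else 0 := by
  intro H'
  have entry (k l : Fin n) : H' k l = H k l - ((H *ᵥ a) m)⁻¹ * ((H *ᵥ a) k * H m l) := by
    simp [H', vecMulVec_apply]
  rw [single_one_dotProduct] at hd
  refine ⟨fun j c hj => ?_, fun k l hk hl => ?_⟩
  · rw [entry]
    rcases hj.eq_or_lt with rfl | hj
    · rw [inv_mul_cancel_left₀ hd, sub_self]
    · have hrow : (H *ᵥ a) j = 0 := by
        simp [mulVec, dotProduct, hzero j _ hj]
      simp [hrow, hzero j c hj]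
  · rw [entry, hone k l hk.le hl.le, hone m l le_rfl hl.le, if_neg hl.ne]
    simp

/-- In the implicit LU method (`H₁ = I`, `zᵢ = wᵢ = vᵢ = eᵢ`),
carried out with nonzero denominators through step `i`, the Abaffian `H_{i+1}`
(here `H i`) has the block structure (13): its first `i` rows are zero, and its
trailing principal `(n−i)×(n−i)` block is the identity. Consequently for each
step `k+1 ≤ i` the last `n−(k+1)` components of the search vector `p_{k+1}`
(here `p k`) are zero and its `(k+1)`-th component equals one. -/
theorem implicit_lu_abaffian_structure
    {n : ℕ}
    (A : Matrix (Fin n) (Fin n) ℝ)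
    (H : ℕ → Matrix (Fin n) (Fin n) ℝ)
    (p : ℕ → Fin n → ℝ)
    (hH0 : H 0 = 1)
    (i : ℕ) (hin : i ≤ n)
    (hp : ∀ k, ∀ hk : k < i, p k = (H k)ᵀ *ᵥ Pi.single ⟨k, hk.trans_le hin⟩ 1)
    (hd : ∀ k, ∀ hk : k < i,
      Pi.single ⟨k, hk.trans_le hin⟩ 1 ⬝ᵥ
        (H k *ᵥ (Aᵀ *ᵥ Pi.single ⟨k, hk.trans_le hin⟩ 1)) ≠ 0)
    (hH : ∀ k, ∀ hk : k < i, H (k + 1) =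
      H k - (Pi.single ⟨k, hk.trans_le hin⟩ 1 ⬝ᵥ
          (H k *ᵥ (Aᵀ *ᵥ Pi.single ⟨k, hk.trans_le hin⟩ 1)))⁻¹ •
        vecMulVec (H k *ᵥ (Aᵀ *ᵥ Pi.single ⟨k, hk.trans_le hin⟩ 1))
          (Pi.single ⟨k, hk.trans_le hin⟩ 1 ᵥ* H k)) :
    (∀ j, ∀ hj : j < i, ∀ c : Fin n, H i ⟨j, hj.trans_le hin⟩ c = 0) ∧
    (∀ k l : Fin n, i ≤ k.1 → i ≤ l.1 → H i k l = if k = l then 1 else 0) ∧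
    (∀ k, ∀ hk : k < i,
      (∀ l : Fin n, k < l.1 → p k l = 0) ∧ p k ⟨k, hk.trans_le hin⟩ = 1) := by
  have invariant : ∀ m, m ≤ i →
      (∀ j c : Fin n, j.1 < m → H m j c = 0) ∧
      ∀ k l : Fin n, m ≤ k.1 → m ≤ l.1 → H m k l = if k = l then 1 else 0 := by
    intro m
    induction m with
    | zero => simp [hH0, Matrix.one_apply]
    | succ m ih =>
      intro hm
      obtain ⟨hzero, hone⟩ := ih (Nat.le_of_succ_le hm)
      obtain ⟨hzero', hone'⟩ :=
        Matrix.abaffian_update_structure (H m) _ ⟨m, Nat.lt_of_lt_of_le hm hin⟩ (hd m hm) hzero hone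
      rw [hH m hm]
      exact ⟨fun j c hj => hzero' j c (Nat.le_of_lt_succ hj), hone'⟩
  obtain ⟨hzero, hone⟩ := invariant i le_rfl
  refine ⟨fun j hj c => hzero _ c hj, hone, fun k hk => ?_⟩
  have hpk (l : Fin n) (hl : k ≤ l.1) :
      p k l = if (⟨k, hk.trans_le hin⟩ : Fin n) = l then 1 else 0 := by
    rw [hp k hk, ← (invariant k hk.le).2 _ l le_rfl hl]
    simp
  refine ⟨fun l hl => ?_, ?_⟩
  · rw [hpk l hl.le, if_neg (Fin.ne_of_lt hl)]
  · rw [hpk _ le_rfl, if_pos rfl]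
end

section
/- Suppose the scaled ABS recursions are carried out with nonzero denominators through step i−1 and the Petrov–Galerkin conditions v_jᵀ (A x_i − b) = 0 hold for j < i. If Hᵢ Aᵀ vᵢ = 0 and vᵢᵀ (A xᵢ − b) ≠ 0, then the system A x = b has no solution. -/
open Matrix

/-- A vector orthogonal to each `a j`, `j < i`, is orthogonal to the null space of the matrix
obtained from a nonsingular one by `i` rank-one updates annihilating `a 0, …, a (i - 1)`. -/
theorem dotProduct_eq_zero_of_rankOne_updates {n : ℕ}
    (H : ℕ → Matrix (Fin n) (Fin n) ℝ) (a w : ℕ → Fin n → ℝ) (d : Fin n → ℝ)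
    (h0 : (H 0).det ≠ 0) (i : ℕ)
    (hH : ∀ k < i, H (k + 1) =
      H k - (w k ⬝ᵥ (H k *ᵥ a k))⁻¹ • vecMulVec (H k *ᵥ a k) (w k ᵥ* H k))
    (had : ∀ j < i, a j ⬝ᵥ d = 0) (u : Fin n → ℝ) (hu : H i *ᵥ u = 0) :
    u ⬝ᵥ d = 0 := by
  induction i generalizing u with
  | zero => rw [eq_zero_of_mulVec_eq_zero h0 hu, zero_dotProduct]
  | succ k ih =>
    set c := (w k ⬝ᵥ (H k *ᵥ a k))⁻¹ * ((w k ᵥ* H k) ⬝ᵥ u)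
    have hker : H k *ᵥ (u - c • a k) = 0 := by
      rw [← hu, hH k k.lt_succ_self, sub_mulVec, smul_mulVec, vecMulVec_mulVec, mulVec_sub,
        mulVec_smul, op_smul_eq_smul, smul_smul]
    have h := ih (fun j hj => hH j (by omega)) (fun j hj => had j (by omega)) _ hker
    simpa [sub_dotProduct, had k k.lt_succ_self] using h

/-- Suppose the scaled ABS recursions are carried out with
nonzero denominators through step `i−1` (here: updates `k < i`, producing `H_i`
and `x_i`, here `H i` and `x i`) and the Petrov–Galerkin conditions
`v_jᵀ (A x_i − b) = 0` hold for `j < i`. If `Hᵢ Aᵀ vᵢ = 0` and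
`vᵢᵀ (A xᵢ − b) ≠ 0`, then the system `A x = b` has no solution. -/
theorem abs_incompatibility
    {m n : ℕ} (hmn : m ≤ n)
    (A : Matrix (Fin m) (Fin n) ℝ) (b : Fin m → ℝ)
    (H : ℕ → Matrix (Fin n) (Fin n) ℝ) (x : ℕ → Fin n → ℝ)
    (v : ℕ → Fin m → ℝ) (z w : ℕ → Fin n → ℝ)
    (p : ℕ → Fin n → ℝ) (α : ℕ → ℝ)
    (hH1 : (H 0).det ≠ 0)
    (i : ℕ) (hi : i < m)
    (hp : ∀ k < i, p k = (H k)ᵀ *ᵥ z k)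
    (hα : ∀ k < i, α k = (v k ⬝ᵥ (A *ᵥ x k - b)) / (v k ⬝ᵥ (A *ᵥ p k)))
    (hx : ∀ k < i, x (k + 1) = x k - α k • p k)
    (hd1 : ∀ k < i, v k ⬝ᵥ (A *ᵥ ((H k)ᵀ *ᵥ z k)) ≠ 0)
    (hd2 : ∀ k < i, w k ⬝ᵥ (H k *ᵥ (Aᵀ *ᵥ v k)) ≠ 0)
    (hH : ∀ k < i, H (k + 1) =
      H k - (w k ⬝ᵥ (H k *ᵥ (Aᵀ *ᵥ v k)))⁻¹ •
        vecMulVec (H k *ᵥ (Aᵀ *ᵥ v k)) (w k ᵥ* H k))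
    (hpg : ∀ j < i, v j ⬝ᵥ (A *ᵥ x i - b) = 0)
    (hs : H i *ᵥ (Aᵀ *ᵥ v i) = 0)
    (hτ : v i ⬝ᵥ (A *ᵥ x i - b) ≠ 0) :
    ¬ ∃ y : Fin n → ℝ, A *ᵥ y = b := by
  rintro ⟨y, rfl⟩
  have hadj (j : ℕ) : (Aᵀ *ᵥ v j) ⬝ᵥ (x i - y) = v j ⬝ᵥ (A *ᵥ x i - A *ᵥ y) := by
    rw [mulVec_transpose, ← dotProduct_mulVec, mulVec_sub]
  refine hτ ((hadj i).symm.trans ?_)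
  exact dotProduct_eq_zero_of_rankOne_updates H (fun j => Aᵀ *ᵥ v j) w _ hH1 i hH
    (fun j hj => (hadj j).trans (hpg j hj)) _ hs
end

section
/- Theorem 1(a) for the Diophantine ABS algorithm: let A ∈ ℤ^{m×n} have full row rank and suppose the system Ax = b (b ∈ ℤ^m) has an integer solution. Run the scaled ABS recursions for the Abaffians with H₁ a unimodular integer matrix, integer scaling vectors v₁,…,v_m, and at each step an integer vector wᵢ satisfying wᵢᵀ Hᵢ Aᵀ vᵢ = δᵢ where δᵢ = gcd of the components of Hᵢ Aᵀ vᵢ. Then at every step the denominator wᵢᵀ Hᵢ Aᵀ vᵢ = δᵢ is a positive integer (so the update is well defined) and every Abaffian H_{i+1} = Hᵢ − (Hᵢ Aᵀ vᵢ)(wᵢᵀ Hᵢ)/δᵢ is an integer matrix. -/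
open Matrix

theorem rankOneUpdate_mulVec {ι R : Type*} [Fintype ι] [CommRing R]
    (H : Matrix ι ι R) (a w x : ι → R) (c : R) :
    (H - c • vecMulVec (H *ᵥ a) (w ᵥ* H)) *ᵥ x =
      H *ᵥ (x - (c * (w ⬝ᵥ H *ᵥ x)) • a) := by
  rw [sub_mulVec, smul_mulVec, vecMulVec_mulVec, mulVec_sub, mulVec_smul,
    ← dotProduct_mulVec, op_smul_eq_smul, smul_smul]

/-- The kernel of the `k`-th Abaffian is contained in the span of the first `k` vectors
that have been eliminated. -/
theorem mem_span_of_abaffian_mulVec_eq_zero {ι R : Type*} [Fintype ι] [CommRing R]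
    {m : ℕ} {H : ℕ → Matrix ι ι R} {a w : ℕ → ι → R} {c : ℕ → R}
    (hH0 : ∀ x, H 0 *ᵥ x = 0 → x = 0)
    (hH : ∀ k < m, H (k + 1) = H k - c k • vecMulVec (H k *ᵥ a k) (w k ᵥ* H k))
    {k : ℕ} (hk : k ≤ m) {x : ι → R} (hx : H k *ᵥ x = 0) :
    x ∈ Submodule.span R (a '' Set.Iio k) := by
  induction k generalizing x with
  | zero => simp [hH0 x hx]
  | succ k ih =>
    rw [hH k hk, rankOneUpdate_mulVec] at hx
    have hmono : a '' Set.Iio k ⊆ a '' Set.Iio (k + 1) :=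
      Set.image_mono (Set.Iio_subset_Iio k.le_succ)
    rw [← sub_add_cancel x ((c k * (w k ⬝ᵥ H k *ᵥ x)) • a k)]
    exact add_mem (Submodule.span_mono hmono (ih (Nat.le_of_succ_le hk) hx))
      (Submodule.smul_mem _ _ (Submodule.subset_span ⟨k, k.lt_succ_self, rfl⟩))

theorem Int.finset_gcd_pos {ι : Type*} [Fintype ι] {s : ι → ℤ} (hs : s ≠ 0) :
    0 < Finset.univ.gcd s := by
  refine lt_of_le_of_ne (Int.nonneg_of_normalize_eq_self Finset.normalize_gcd) fun h => hs ?_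
  ext i
  exact Finset.gcd_eq_zero_iff.1 h.symm i (Finset.mem_univ i)

/-- Subtracting `(s wᵀ) / d` from an integer matrix leaves it an integer matrix when `d`
divides every component of `s`. -/
theorem exists_int_matrix_sub_inv_smul_vecMulVec {ι κ : Type*}
    (M : Matrix ι κ ℤ) {s : ι → ℤ} (u : κ → ℤ) {d : ℤ} (hd : d ≠ 0) (hs : ∀ i, d ∣ s i) :
    ∃ N : Matrix ι κ ℤ, M.map (Int.cast : ℤ → ℚ) -
      (d : ℚ)⁻¹ • vecMulVec (fun i => (s i : ℚ)) (fun j => (u j : ℚ)) =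
        N.map (Int.cast : ℤ → ℚ) := by
  choose t ht using hs
  have hd' : (d : ℚ) ≠ 0 := Int.cast_ne_zero.2 hd
  refine ⟨M - vecMulVec t u, ?_⟩
  ext i j
  simp only [Matrix.sub_apply, Matrix.smul_apply, map_apply, vecMulVec_apply, smul_eq_mul, ht]
  push_cast
  field_simp

/-- Theorem 1(a) for the Diophantine ABS algorithm. Let
`A ∈ ℤ^{m×n}` have full row rank and suppose `Ax = b` has an integer solution.
Run the scaled ABS recursions for the Abaffians (over `ℚ`) with `H₁` a
unimodular integer matrix, integer scaling vectors `v₁,…,v_m` (linearly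
independent), and at each step an integer vector `wᵢ` with
`wᵢᵀ Hᵢ Aᵀ vᵢ = δᵢ = gcd(Hᵢ Aᵀ vᵢ)`. Then at every step the denominator
`δᵢ` is a positive integer (so the update is well defined) and every Abaffian
is an integer matrix. -/
theorem diophantine_abs_integer_abaffians
    {m n : ℕ} (hmn : m ≤ n)
    (A : Matrix (Fin m) (Fin n) ℤ) (b : Fin m → ℤ)
    (hrank : LinearIndependent ℚ (fun i : Fin m => fun j : Fin n => (A i j : ℚ)))
    (hsol : ∃ x : Fin n → ℤ, A *ᵥ x = b)
    (H₁ : Matrix (Fin n) (Fin n) ℤ) (hH₁ : IsUnit H₁.det)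
    (v : ℕ → Fin m → ℤ) (w : ℕ → Fin n → ℤ)
    (hv : LinearIndependent ℚ (fun k : Fin m => fun t : Fin m => (v k.1 t : ℚ)))
    (H : ℕ → Matrix (Fin n) (Fin n) ℚ)
    (hH0 : H 0 = H₁.map (Int.cast : ℤ → ℚ))
    (δ : ℕ → ℤ)
    (hgcd : ∀ k < m, ∀ s : Fin n → ℤ,
      (fun t => (s t : ℚ)) =
        H k *ᵥ ((A.map (Int.cast : ℤ → ℚ))ᵀ *ᵥ fun t => (v k t : ℚ)) →
      δ k = Finset.univ.gcd s ∧ w k ⬝ᵥ s = δ k)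
    (hH : ∀ k < m, H (k + 1) =
      H k - ((fun t => (w k t : ℚ)) ⬝ᵥ
          (H k *ᵥ ((A.map (Int.cast : ℤ → ℚ))ᵀ *ᵥ fun t => (v k t : ℚ))))⁻¹ •
        vecMulVec (H k *ᵥ ((A.map (Int.cast : ℤ → ℚ))ᵀ *ᵥ fun t => (v k t : ℚ)))
          ((fun t => (w k t : ℚ)) ᵥ* H k)) :
    (∀ k < m, 0 < δ k) ∧
    (∀ k ≤ m, ∃ M : Matrix (Fin n) (Fin n) ℤ, H k = M.map (Int.cast : ℤ → ℚ)) := by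
  have hA : Function.Injective ((A.map (Int.cast : ℤ → ℚ))ᵀ).mulVec :=
    mulVec_injective_iff.2 hrank
  set a : ℕ → Fin n → ℚ :=
    fun k => (A.map (Int.cast : ℤ → ℚ))ᵀ *ᵥ fun t => (v k t : ℚ) with ha
  have ha_indep : LinearIndependent ℚ (fun k : Fin m => a k) :=
    hv.map' (mulVecLin (A.map (Int.cast : ℤ → ℚ))ᵀ) (LinearMap.ker_eq_bot.2 hA)
  have hker0 : ∀ x, H 0 *ᵥ x = 0 → x = 0 := by
    refine fun x hx => eq_zero_of_mulVec_eq_zero ?_ hx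
    rw [hH0]
    exact Int.cast_det (R := ℚ) H₁ ▸ Int.cast_ne_zero.2 hH₁.ne_zero
  have hne : ∀ k < m, H k *ᵥ a k ≠ 0 := by
    intro k hk h0
    have hmem := mem_span_of_abaffian_mulVec_eq_zero (a := a) hker0 hH hk.le h0
    refine ha_indep.notMem_span_image (s := {j | j.1 < k}) (x := ⟨k, hk⟩) (by simp)
      (Submodule.span_mono ?_ hmem)
    rintro _ ⟨j, hj, rfl⟩
    exact ⟨⟨j, lt_trans hj hk⟩, hj, rfl⟩
  have step : ∀ k < m, ∀ M : Matrix (Fin n) (Fin n) ℤ, H k = M.map (Int.cast : ℤ → ℚ) →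
      0 < δ k ∧ ∃ N : Matrix (Fin n) (Fin n) ℤ, H (k + 1) = N.map (Int.cast : ℤ → ℚ) := by
    intro k hk M hM
    set s : Fin n → ℤ := M *ᵥ (Aᵀ *ᵥ v k) with hs
    have hcast : (fun t => (s t : ℚ)) = H k *ᵥ a k := by
      ext t
      simp [hM, hs, ha, -mulVec_mulVec, mulVec, dotProduct]
    obtain ⟨hδ, hw⟩ := hgcd k hk s hcast
    have hs0 : s ≠ 0 := by
      intro h
      apply hne k hk
      rw [← hcast, h]
      ext
      simp
    have hpos : 0 < δ k := hδ ▸ Int.finset_gcd_pos hs0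
    have hden : (fun t => (w k t : ℚ)) ⬝ᵥ (fun t => (s t : ℚ)) = (δ k : ℚ) := by
      simp [← hw, dotProduct]
    have hrow : (fun t => (w k t : ℚ)) ᵥ* H k = fun t => ((w k ᵥ* M) t : ℚ) := by
      ext t
      simp [hM, vecMul, dotProduct]
    obtain ⟨N, hN⟩ := exists_int_matrix_sub_inv_smul_vecMulVec M (w k ᵥ* M) hpos.ne'
      (fun i => hδ ▸ Finset.gcd_dvd (Finset.mem_univ i) : ∀ i, δ k ∣ s i)
    refine ⟨hpos, N, ?_⟩
    rw [hH k hk, ← hN]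
    change H k - (_ ⬝ᵥ (H k *ᵥ a k))⁻¹ • vecMulVec (H k *ᵥ a k) _ = _
    rw [hrow, ← hcast, hden, hM]
  have hint : ∀ k ≤ m, ∃ M : Matrix (Fin n) (Fin n) ℤ, H k = M.map (Int.cast : ℤ → ℚ) := by
    intro k hk
    induction k with
    | zero => exact ⟨H₁, hH0⟩
    | succ k ih =>
      obtain ⟨M, hM⟩ := ih (Nat.le_of_succ_le hk)
      exact (step k hk M hM).2
  refine ⟨fun k hk => ?_, hint⟩
  obtain ⟨M, hM⟩ := hint k hk.le
  exact (step k hk M hM).1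
end

section
/- Theorem 1(b) for the Diophantine ABS algorithm: let A ∈ ℤ^{m×n} have full row rank and suppose Ax = b (b ∈ ℤ^m) has an integer solution. With the Abaffians H_{i+1} generated as in Theorem 1(a) (H₁ unimodular integer, wᵢ integer with wᵢᵀ Hᵢ Aᵀ vᵢ = gcd of the components of Hᵢ Aᵀ vᵢ), if y ∈ ℤⁿ satisfies the first i equations vⱼᵀ(A y − b) = 0 for j ≤ i, then every integer vector x satisfying those same i equations can be written as x = y + H_{i+1}ᵀ q for some integer vector q ∈ ℤⁿ. -/
open Matrix

/-- A rank-one update of `H` with left vector `s = H *ᵥ a` does not change `Hᵀ *ᵥ q` when that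
vector is orthogonal to `a`. -/
theorem transpose_sub_smul_vecMulVec_mulVec {R ι : Type*} [CommRing R] [Fintype ι]
    (H : Matrix ι ι R) (a q u : ι → R) (c : R) (h : a ⬝ᵥ (Hᵀ *ᵥ q) = 0) :
    (H - c • vecMulVec (H *ᵥ a) u)ᵀ *ᵥ q = Hᵀ *ᵥ q := by
  have hs : (H *ᵥ a) ⬝ᵥ q = 0 := by
    rwa [dotProduct_comm, dotProduct_mulVec, ← mulVec_transpose, dotProduct_comm]
  simp [transpose_sub, transpose_smul, transpose_vecMulVec, sub_mulVec, smul_mulVec,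
    vecMulVec_mulVec, hs]

/-- The transpose of a matrix with invertible determinant is surjective. -/
theorem exists_transpose_mulVec_eq_of_isUnit_det {R ι : Type*} [CommRing R] [Fintype ι]
    [DecidableEq ι] (H : Matrix ι ι R) (hH : IsUnit H.det) (d : ι → R) :
    ∃ q : ι → R, Hᵀ *ᵥ q = d :=
  ⟨Hᵀ⁻¹ *ᵥ d, by
    rw [mulVec_mulVec, mul_nonsing_inv _ (by rwa [det_transpose]), one_mulVec]⟩

/-- Theorem 1(b) for the Diophantine ABS algorithm. Let
`A ∈ ℤ^{m×n}` have full row rank and suppose `Ax = b` has an integer solution.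
With the Abaffians generated as in Theorem 1(a) (`H₁` unimodular integer,
`wᵢ` integer with `wᵢᵀ Hᵢ Aᵀ vᵢ = gcd(Hᵢ Aᵀ vᵢ)`), if `y ∈ ℤⁿ` satisfies the
first `i` equations `vⱼᵀ(A y − b) = 0` for `j ≤ i`, then every integer vector
`x` satisfying those same `i` equations can be written as `x = y + H_{i+1}ᵀ q`
(here `H i`) for some integer vector `q`. -/
theorem diophantine_abs_general_integer_solution
    {m n : ℕ} (hmn : m ≤ n)
    (A : Matrix (Fin m) (Fin n) ℤ) (b : Fin m → ℤ)
    (hrank : LinearIndependent ℚ (fun i : Fin m => fun j : Fin n => (A i j : ℚ)))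
    (hsol : ∃ x : Fin n → ℤ, A *ᵥ x = b)
    (H₁ : Matrix (Fin n) (Fin n) ℤ) (hH₁ : IsUnit H₁.det)
    (v : ℕ → Fin m → ℤ) (w : ℕ → Fin n → ℤ)
    (hv : LinearIndependent ℚ (fun k : Fin m => fun t : Fin m => (v k.1 t : ℚ)))
    (H : ℕ → Matrix (Fin n) (Fin n) ℚ)
    (hH0 : H 0 = H₁.map (Int.cast : ℤ → ℚ))
    (δ : ℕ → ℤ)
    (hgcd : ∀ k < m, ∀ s : Fin n → ℤ,
      (fun t => (s t : ℚ)) =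
        H k *ᵥ ((A.map (Int.cast : ℤ → ℚ))ᵀ *ᵥ fun t => (v k t : ℚ)) →
      δ k = Finset.univ.gcd s ∧ w k ⬝ᵥ s = δ k)
    (hH : ∀ k < m, H (k + 1) =
      H k - ((fun t => (w k t : ℚ)) ⬝ᵥ
          (H k *ᵥ ((A.map (Int.cast : ℤ → ℚ))ᵀ *ᵥ fun t => (v k t : ℚ))))⁻¹ •
        vecMulVec (H k *ᵥ ((A.map (Int.cast : ℤ → ℚ))ᵀ *ᵥ fun t => (v k t : ℚ)))
          ((fun t => (w k t : ℚ)) ᵥ* H k))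
    (i : ℕ) (hi : i ≤ m)
    (y : Fin n → ℤ) (hy : ∀ j < i, v j ⬝ᵥ (A *ᵥ y - b) = 0) :
    ∀ x : Fin n → ℤ, (∀ j < i, v j ⬝ᵥ (A *ᵥ x - b) = 0) →
      ∃ q : Fin n → ℤ,
        (fun t => (x t : ℚ)) =
          (fun t => (y t : ℚ)) + (H i)ᵀ *ᵥ fun t => (q t : ℚ) := by
  intro x hx
  obtain ⟨q, hq⟩ := exists_transpose_mulVec_eq_of_isUnit_det H₁ hH₁ (x - y)
  have horth (k : ℕ) (hk : k < i) :
      ((A.map (Int.cast : ℤ → ℚ))ᵀ *ᵥ fun t => (v k t : ℚ)) ⬝ᵥ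
        (fun t => ((x - y) t : ℚ)) = 0 := by
    have hz : (Aᵀ *ᵥ v k) ⬝ᵥ (x - y) = 0 := by
      rw [mulVec_transpose, ← dotProduct_mulVec, mulVec_sub,
        ← sub_sub_sub_cancel_right (A *ᵥ x) (A *ᵥ y) b, dotProduct_sub, hx k hk, hy k hk, sub_zero]
    have hc := congrArg (Int.cast : ℤ → ℚ) hz
    simpa [dotProduct, mulVec] using hc
  have hinv (k : ℕ) : k ≤ i →
      (H k)ᵀ *ᵥ (fun t => (q t : ℚ)) = fun t => ((x - y) t : ℚ) := by
    induction k with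
    | zero =>
      intro _
      rw [hH0, ← hq]
      ext t
      simp [dotProduct, mulVec]
    | succ k ih =>
      intro hk
      have hkq := ih (by omega)
      rw [hH k (by omega), transpose_sub_smul_vecMulVec_mulVec _ _ _ _ _
        (by rw [hkq]; exact horth k hk), hkq]
  refine ⟨q, ?_⟩
  rw [hinv i le_rfl]
  ext t
  simp
end

section
/- Theorem 2 for the Diophantine ABS algorithm: let A ∈ ℤ^{m×n} have full row rank, b ∈ ℤ^m, and run the scaled ABS algorithm with an arbitrary integer starting vector x₁ ∈ ℤⁿ, H₁ unimodular integer, integer scaling vectors v₁,…,v_m linearly independent, integer vectors zᵢ, wᵢ satisfying zᵢᵀ Hᵢ Aᵀ vᵢ = wᵢᵀ Hᵢ Aᵀ vᵢ = δᵢ := gcd of the components of Hᵢ Aᵀ vᵢ, and stepsize αᵢ = vᵢᵀ rᵢ / δᵢ, x_{i+1} = xᵢ − αᵢ Hᵢᵀ zᵢ, rᵢ = A xᵢ − b. Then the system Ax = b has an integer solution if and only if δᵢ divides vᵢᵀ rᵢ for every i = 1,…,m. -/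
open Matrix

theorem dotProduct_intCast {ι : Type*} [Fintype ι] (p q : ι → ℤ) :
    (fun t => (p t : ℚ)) ⬝ᵥ (fun t => (q t : ℚ)) = ((p ⬝ᵥ q : ℤ) : ℚ) := by
  simp [dotProduct]

theorem map_intCast_mulVec {ι κ : Type*} [Fintype κ] (B : Matrix ι κ ℤ) (p : κ → ℤ) :
    (B.map (Int.cast : ℤ → ℚ)) *ᵥ (fun t => (p t : ℚ)) = fun t => ((B *ᵥ p) t : ℚ) := by
  ext t
  simp [mulVec, dotProduct]

theorem map_intCast_vecMul {ι κ : Type*} [Fintype ι] (p : ι → ℤ) (B : Matrix ι κ ℤ) :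
    (fun t => (p t : ℚ)) ᵥ* (B.map (Int.cast : ℤ → ℚ)) = fun t => ((p ᵥ* B) t : ℚ) := by
  ext t
  simp [vecMul, dotProduct]

theorem exists_eq_gcd_smul {ι : Type*} [Fintype ι] (s : ι → ℤ) :
    ∃ u : ι → ℤ, s = Finset.univ.gcd s • u ∧ (Finset.univ.gcd s = 0 → u = 0) := by
  by_cases h : Finset.univ.gcd s = 0
  · refine ⟨0, ?_, fun _ => rfl⟩
    ext t
    simpa using Finset.gcd_eq_zero_iff.mp h t (Finset.mem_univ t)
  · choose u hu using fun t => Finset.gcd_dvd (f := s) (Finset.mem_univ t)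
    exact ⟨u, funext hu, fun h' => absurd h' h⟩

/-- One step of the integer ABS recursion intersects the affine lattice `x + ℤⁿ H` with the
hyperplane `a ⬝ᵥ y = β`. -/
theorem abs_step_affine_lattice {n : ℕ} (H : Matrix (Fin n) (Fin n) ℤ)
    (a x z w u : Fin n → ℤ) (β c δ : ℤ)
    (hs : H *ᵥ a = δ • u) (hu : δ = 0 → u = 0)
    (hz : z ⬝ᵥ (H *ᵥ a) = δ) (hw : w ⬝ᵥ (H *ᵥ a) = δ)
    (hc : x ⬝ᵥ a - β = c * δ) (y : Fin n → ℤ) :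
    ((∃ q, y = x + q ᵥ* H) ∧ y ⬝ᵥ a = β) ↔
      ∃ q, y = (x - c • (z ᵥ* H)) + q ᵥ* (H - vecMulVec u (w ᵥ* H)) := by
  have hq (q : Fin n → ℤ) : q ⬝ᵥ (H *ᵥ a) = δ * (q ⬝ᵥ u) := by
    rw [hs, dotProduct_smul, smul_eq_mul]
  have hH (q : Fin n → ℤ) : q ᵥ* (H - vecMulVec u (w ᵥ* H)) =
      (q - (q ⬝ᵥ u) • w) ᵥ* H := by
    rw [vecMul_sub, vecMul_vecMulVec, sub_vecMul, smul_vecMul]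
  constructor
  · rintro ⟨⟨q, rfl⟩, hy⟩
    refine ⟨q + c • z, ?_⟩
    have h0 : (q + c • z) ⬝ᵥ u = 0 := by
      by_cases hδ : δ = 0
      · simp [hu hδ]
      · refine (mul_eq_zero.mp ?_).resolve_left hδ
        rw [← hq, add_dotProduct, smul_dotProduct, hz]
        rw [add_dotProduct, ← dotProduct_mulVec] at hy
        simp only [smul_eq_mul]
        linarith
    rw [hH, h0, zero_smul, sub_zero, add_vecMul, smul_vecMul]
    abel
  · rintro ⟨q, rfl⟩
    rw [hH]
    refine ⟨⟨q - (q ⬝ᵥ u) • w - c • z, ?_⟩, ?_⟩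
    · simp only [sub_vecMul, smul_vecMul]
      abel
    · simp only [add_dotProduct, sub_dotProduct, smul_dotProduct, ← dotProduct_mulVec, hz, hw,
        smul_eq_mul]
      linarith [hq q]

theorem dotProduct_eq_of_linearIndependent {m : ℕ} (v : Fin m → Fin m → ℤ)
    (hv : LinearIndependent ℚ (fun k t : Fin m => (v k t : ℚ))) (p q : Fin m → ℤ)
    (h : ∀ k, v k ⬝ᵥ p = v k ⬝ᵥ q) : p = q := by
  have hV : IsUnit (Matrix.of fun k t : Fin m => (v k t : ℚ)) :=
    linearIndependent_rows_iff_isUnit.mp hv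
  have : (fun t => (p t : ℚ)) = fun t => (q t : ℚ) := by
    apply mulVec_injective_of_isUnit hV
    ext k
    change (fun t => (v k t : ℚ)) ⬝ᵥ _ = (fun t => (v k t : ℚ)) ⬝ᵥ _
    rw [dotProduct_intCast, dotProduct_intCast, h]
  ext t
  exact_mod_cast congrFun this t

/-- The matrix `H` and the vector `x` are integral and parametrize the integer solutions of the
first `k` equations `y ⬝ᵥ a j = β j`. -/
def ParametrizesSolutions {n : ℕ} (a : ℕ → Fin n → ℤ) (β : ℕ → ℤ) (k : ℕ)
    (H : Matrix (Fin n) (Fin n) ℚ) (x : Fin n → ℚ) : Prop :=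
  ∃ (H' : Matrix (Fin n) (Fin n) ℤ) (x' : Fin n → ℤ),
    H = H'.map (Int.cast : ℤ → ℚ) ∧ (x = fun t => (x' t : ℚ)) ∧
      ∀ y : Fin n → ℤ, (∀ j < k, y ⬝ᵥ a j = β j) ↔ ∃ q, y = x' + q ᵥ* H'

theorem parametrizesSolutions_zero {n : ℕ} (a : ℕ → Fin n → ℤ) (β : ℕ → ℤ)
    (H' : Matrix (Fin n) (Fin n) ℤ) (hH' : IsUnit H'.det) (x' : Fin n → ℤ) :
    ParametrizesSolutions a β 0 (H'.map (Int.cast : ℤ → ℚ)) (fun t => (x' t : ℚ)) := by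
  refine ⟨H', x', rfl, rfl, fun y => ⟨fun _ => ⟨(y - x') ᵥ* H'⁻¹, ?_⟩, fun _ j hj => ?_⟩⟩
  · rw [vecMul_vecMul, nonsing_inv_mul _ hH', vecMul_one]
    abel
  · exact absurd hj (Nat.not_lt_zero j)

theorem ParametrizesSolutions.succ {n k : ℕ} {a : ℕ → Fin n → ℤ} {β : ℕ → ℤ}
    {H : Matrix (Fin n) (Fin n) ℚ} {x : Fin n → ℚ} {z w : Fin n → ℤ} {δ : ℤ}
    (h : ParametrizesSolutions a β k H x)
    (hgcd : ∀ s : Fin n → ℤ, (fun t => (s t : ℚ)) = H *ᵥ (fun t => (a k t : ℚ)) →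
      δ = Finset.univ.gcd s ∧ z ⬝ᵥ s = δ ∧ w ⬝ᵥ s = δ)
    {ρ : ℚ} (hρ : ρ = x ⬝ᵥ (fun t => (a k t : ℚ)) - β k) (hdvd : ∃ c : ℤ, ρ = ((c * δ : ℤ) : ℚ)) :
    ParametrizesSolutions a β (k + 1)
      (H - ((fun t => (w t : ℚ)) ⬝ᵥ (H *ᵥ fun t => (a k t : ℚ)))⁻¹ •
        vecMulVec (H *ᵥ fun t => (a k t : ℚ)) ((fun t => (w t : ℚ)) ᵥ* H))
      (x - (ρ / (δ : ℚ)) • (Hᵀ *ᵥ fun t => (z t : ℚ))) := by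
  obtain ⟨H', x', rfl, rfl, hsol⟩ := h
  rw [map_intCast_mulVec] at hgcd ⊢
  obtain ⟨hδ, hz, hw⟩ := hgcd (H' *ᵥ a k) rfl
  obtain ⟨u, hs, hu⟩ := exists_eq_gcd_smul (H' *ᵥ a k)
  rw [← hδ] at hs hu
  obtain ⟨c, hc, hcδ⟩ : ∃ c : ℤ, ρ = ((c * δ : ℤ) : ℚ) ∧ ρ / (δ : ℚ) = c := by
    obtain ⟨c, hc⟩ := hdvd
    by_cases h0 : δ = 0
    · exact ⟨0, by simp [hc, h0], by simp [h0]⟩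
    · have : (δ : ℚ) ≠ 0 := by exact_mod_cast h0
      exact ⟨c, hc, by rw [hc]; push_cast; field_simp⟩
  have hc' : x' ⬝ᵥ a k - β k = c * δ := by
    rw [dotProduct_intCast, hc] at hρ
    exact_mod_cast hρ.symm
  refine ⟨H' - vecMulVec u (w ᵥ* H'), x' - c • (z ᵥ* H'), ?_, ?_, fun y => ?_⟩
  · have hsu : (δ : ℚ)⁻¹ • (fun t => ((H' *ᵥ a k) t : ℚ)) = fun t => (u t : ℚ) := by
      ext t
      by_cases h0 : δ = 0
      · simp [h0, hu h0]
      · have : (δ : ℚ) ≠ 0 := by exact_mod_cast h0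
        simp [hs, this]
    rw [dotProduct_intCast, hw, map_intCast_vecMul, ← smul_vecMulVec, hsu]
    ext i j
    simp [vecMulVec_apply]
  · rw [hcδ, mulVec_transpose, map_intCast_vecMul]
    ext t
    simp
  · rw [← abs_step_affine_lattice H' (a k) x' z w u (β k) c δ hs hu hz hw hc' y, ← hsol,
      Nat.forall_lt_succ_right]

theorem ParametrizesSolutions.exists_mul_gcd {n k : ℕ} {a : ℕ → Fin n → ℤ} {β : ℕ → ℤ}
    {H : Matrix (Fin n) (Fin n) ℚ} {x : Fin n → ℚ} {δ : ℤ}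
    (h : ParametrizesSolutions a β k H x)
    (hgcd : ∀ s : Fin n → ℤ, (fun t => (s t : ℚ)) = H *ᵥ (fun t => (a k t : ℚ)) →
      δ = Finset.univ.gcd s)
    {y : Fin n → ℤ} (hy : ∀ j < k + 1, y ⬝ᵥ a j = β j) :
    ∃ c : ℤ, x ⬝ᵥ (fun t => (a k t : ℚ)) - β k = ((c * δ : ℤ) : ℚ) := by
  obtain ⟨H', x', rfl, rfl, hsol⟩ := h
  have hδ := hgcd (H' *ᵥ a k) (map_intCast_mulVec _ _).symm
  obtain ⟨u, hs, -⟩ := exists_eq_gcd_smul (H' *ᵥ a k)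
  rw [← hδ] at hs
  obtain ⟨q, rfl⟩ := (hsol y).mp fun j hj => hy j (hj.trans k.lt_succ_self)
  have hk := hy k k.lt_succ_self
  rw [add_dotProduct, ← dotProduct_mulVec, hs, dotProduct_smul, smul_eq_mul] at hk
  refine ⟨-(q ⬝ᵥ u), ?_⟩
  rw [dotProduct_intCast, ← hk]
  push_cast
  ring

/-- Theorem 2 for the Diophantine ABS algorithm. Let
`A ∈ ℤ^{m×n}` have full row rank, `b ∈ ℤ^m`, and run the scaled ABS algorithm
(over `ℚ`) with an integer starting vector `x₁`, `H₁` unimodular integer,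
linearly independent integer scaling vectors `v₁,…,v_m`, integer vectors
`zᵢ, wᵢ` with `zᵢᵀ Hᵢ Aᵀ vᵢ = wᵢᵀ Hᵢ Aᵀ vᵢ = δᵢ = gcd(Hᵢ Aᵀ vᵢ)`, and stepsize
`αᵢ = vᵢᵀ rᵢ / δᵢ`, `x_{i+1} = xᵢ − αᵢ Hᵢᵀ zᵢ`. Then `Ax = b` has an integer
solution iff `δᵢ` divides `vᵢᵀ rᵢ` for every `i = 1,…,m`. -/
theorem diophantine_abs_solvability_criterion
    {m n : ℕ} (hmn : m ≤ n)
    (A : Matrix (Fin m) (Fin n) ℤ) (b : Fin m → ℤ)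
    (hrank : LinearIndependent ℚ (fun i : Fin m => fun j : Fin n => (A i j : ℚ)))
    (H₁ : Matrix (Fin n) (Fin n) ℤ) (hH₁ : IsUnit H₁.det)
    (v : ℕ → Fin m → ℤ) (z w : ℕ → Fin n → ℤ)
    (hv : LinearIndependent ℚ (fun k : Fin m => fun t : Fin m => (v k.1 t : ℚ)))
    (H : ℕ → Matrix (Fin n) (Fin n) ℚ)
    (hH0 : H 0 = H₁.map (Int.cast : ℤ → ℚ))
    (x : ℕ → Fin n → ℚ) (x₁ : Fin n → ℤ)
    (hx0 : x 0 = fun t => (x₁ t : ℚ))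
    (δ : ℕ → ℤ)
    (hgcd : ∀ k < m, ∀ s : Fin n → ℤ,
      (fun t => (s t : ℚ)) =
        H k *ᵥ ((A.map (Int.cast : ℤ → ℚ))ᵀ *ᵥ fun t => (v k t : ℚ)) →
      δ k = Finset.univ.gcd s ∧ z k ⬝ᵥ s = δ k ∧ w k ⬝ᵥ s = δ k)
    (hx : ∀ k < m, x (k + 1) =
      x k - (((fun t => (v k t : ℚ)) ⬝ᵥ
          ((A.map (Int.cast : ℤ → ℚ)) *ᵥ x k - fun t => (b t : ℚ))) / (δ k : ℚ)) •
        ((H k)ᵀ *ᵥ fun t => (z k t : ℚ)))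
    (hH : ∀ k < m, H (k + 1) =
      H k - ((fun t => (w k t : ℚ)) ⬝ᵥ
          (H k *ᵥ ((A.map (Int.cast : ℤ → ℚ))ᵀ *ᵥ fun t => (v k t : ℚ))))⁻¹ •
        vecMulVec (H k *ᵥ ((A.map (Int.cast : ℤ → ℚ))ᵀ *ᵥ fun t => (v k t : ℚ)))
          ((fun t => (w k t : ℚ)) ᵥ* H k)) :
    (∃ y : Fin n → ℤ, A *ᵥ y = b) ↔
    (∀ k < m, ∃ c : ℤ,
      (fun t => (v k t : ℚ)) ⬝ᵥ
        ((A.map (Int.cast : ℤ → ℚ)) *ᵥ x k - fun t => (b t : ℚ)) =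
      ((c * δ k : ℤ) : ℚ)) := by
  let a : ℕ → Fin n → ℤ := fun k => Aᵀ *ᵥ v k
  let β : ℕ → ℤ := fun k => v k ⬝ᵥ b
  have haQ (k : ℕ) : ((A.map (Int.cast : ℤ → ℚ))ᵀ *ᵥ fun t => (v k t : ℚ)) =
      fun t => (a k t : ℚ) := by
    rw [← transpose_map, map_intCast_mulVec]
  have hres (k : ℕ) (p : Fin n → ℚ) : (fun t => (v k t : ℚ)) ⬝ᵥ
      ((A.map (Int.cast : ℤ → ℚ)) *ᵥ p - fun t => (b t : ℚ)) =
        p ⬝ᵥ (fun t => (a k t : ℚ)) - β k := by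
    rw [dotProduct_sub, dotProduct_intCast, dotProduct_mulVec, ← mulVec_transpose, haQ,
      dotProduct_comm]
  have hay (k : ℕ) (y : Fin n → ℤ) : y ⬝ᵥ a k = v k ⬝ᵥ (A *ᵥ y) := by
    rw [dotProduct_mulVec, dotProduct_comm, vecMul_transpose]
  simp only [haQ, hres] at hgcd hx hH ⊢
  have hzero : ParametrizesSolutions a β 0 (H 0) (x 0) := by
    rw [hH0, hx0]
    exact parametrizesSolutions_zero a β H₁ hH₁ x₁
  have hsucc {k : ℕ} (hk : k < m) (h : ParametrizesSolutions a β k (H k) (x k))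
      (hdvd : ∃ c : ℤ, x k ⬝ᵥ (fun t => (a k t : ℚ)) - β k = ((c * δ k : ℤ) : ℚ)) :
      ParametrizesSolutions a β (k + 1) (H (k + 1)) (x (k + 1)) := by
    rw [hH k hk, hx k hk]
    exact h.succ (hgcd k hk) rfl hdvd
  constructor
  · rintro ⟨y, hy⟩
    have hdvd {k : ℕ} (hk : k < m) (h : ParametrizesSolutions a β k (H k) (x k)) :=
      h.exists_mul_gcd (fun s hs => (hgcd k hk s hs).1) (y := y) fun j _ => by rw [hay, hy]
    have hpar (k : ℕ) (hk : k ≤ m) : ParametrizesSolutions a β k (H k) (x k) := by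
      induction k with
      | zero => exact hzero
      | succ k ih => exact hsucc hk (ih (by omega)) (hdvd hk (ih (by omega)))
    exact fun k hk => hdvd hk (hpar k hk.le)
  · intro hdvd
    have hpar (k : ℕ) (hk : k ≤ m) : ParametrizesSolutions a β k (H k) (x k) := by
      induction k with
      | zero => exact hzero
      | succ k ih => exact hsucc hk (ih (by omega)) (hdvd k hk)
    obtain ⟨H', y, -, -, hsol⟩ := hpar m le_rfl
    refine ⟨y, dotProduct_eq_of_linearIndependent (fun k => v k) hv _ _ fun k => ?_⟩
    rw [← hay]
    exact (hsol y).mpr ⟨0, by simp⟩ k k.2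
end
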